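/- arXiv:math/0305305 — 3 statements merged into one kernel-verified Lean document; each statement's English description precedes it below -/
import Mathlib

section
/- Let p be a prime. Then the number F_{g PR, h RPPR}(p) of pairs (g,h) with 1 ≤ g,h ≤ p-1 such that g^h ≡ h (mod p), g is a primitive root modulo p, and h is a primitive root modulo p with gcd(h,p-1)=1, satisfies |F_{g PR, h RPPR}(p) − φ(p-1)²/(p-1)| ≤ d(p-1)² · √p · (1 + ln p). -/
theorem fp_geo (z : ℂ) (hz : ‖z‖ = 1) (h1 : z ≠ 1) (M : ℕ) :
    ‖∑ j ∈ Finset.range M, z ^ j‖ ≤ 2 / ‖z - 1‖ := by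
  rw [geom_sum_eq h1, norm_div]
  gcongr
  calc ‖z ^ M - 1‖ ≤ ‖z ^ M‖ + ‖(1 : ℂ)‖ := norm_sub_le _ _
    _ = 2 := by rw [norm_pow, hz]; norm_num

theorem fp_sin (p k : ℕ) (hk : 1 ≤ k) (hkp : k < p) :
    1 / Real.sin (Real.pi * k / p) ≤ (p : ℝ) / 2 * (1 / k + 1 / (p - k : ℕ)) ∧
      0 < Real.sin (Real.pi * k / p) := by
  have hp0 : (0 : ℝ) < p := by exact_mod_cast (by omega : 0 < p)
  have hk0 : (0 : ℝ) < k := by exact_mod_cast hk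
  have hc : ((p - k : ℕ) : ℝ) = p - k := by push_cast [hkp.le]; ring
  have hq0 : (0 : ℝ) < p - k := by
    have : (k : ℝ) < p := by exact_mod_cast hkp
    linarith
  rw [hc]
  have hpi := Real.pi_pos
  rcases le_total (2 * (k : ℝ)) p with h | h
  · have h1 := Real.mul_le_sin (x := Real.pi * k / p) (by positivity) (by
      rw [div_le_div_iff₀ hp0 (by norm_num)]; nlinarith)
    have h2 : 2 / Real.pi * (Real.pi * k / p) = 2 * k / p := by field_simp
    rw [h2] at h1
    have h3 : (0 : ℝ) < 2 * k / p := by positivity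
    refine ⟨?_, h3.trans_le h1⟩
    calc _ ≤ 1 / (2 * k / p : ℝ) := one_div_le_one_div_of_le h3 h1
      _ = (p : ℝ) / 2 * (1 / k + 0) := by field_simp; ring
      _ ≤ _ := by gcongr; positivity
  · have h0 : Real.sin (Real.pi * k / p) = Real.sin (Real.pi * (p - k) / p) := by
      rw [← Real.sin_pi_sub]; congr 1; field_simp
    rw [h0]
    have h1 := Real.mul_le_sin (x := Real.pi * (p - k) / p) (by positivity) (by
      rw [div_le_div_iff₀ hp0 (by norm_num)]; nlinarith)
    have h2 : 2 / Real.pi * (Real.pi * (p - k) / p) = 2 * (p - k) / p := by field_simp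
    rw [h2] at h1
    have h3 : (0 : ℝ) < 2 * (p - k) / p := by positivity
    refine ⟨?_, h3.trans_le h1⟩
    calc _ ≤ 1 / (2 * (p - k) / p : ℝ) := one_div_le_one_div_of_le h3 h1
      _ = (p : ℝ) / 2 * (0 + 1 / (p - k)) := by field_simp; ring
      _ ≤ _ := by gcongr; positivity

theorem fp_psi (p : ℕ) [Fact p.Prime] (k : ℕ) (hk : 1 ≤ k) (hkp : k < p) (M : ℕ) :
    ‖∑ j ∈ Finset.range M, (ZMod.stdAddChar ((k : ZMod p) * (j : ZMod p)) : ℂ)‖ ≤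
      (p : ℝ) / 2 * (1 / k + 1 / (p - k : ℕ)) := by
  have hp0 : (0 : ℝ) < p := by exact_mod_cast (by omega : 0 < p)
  set z : ℂ := ZMod.stdAddChar (k : ZMod p) with hz
  have e1 : ∀ j : ℕ, (ZMod.stdAddChar ((k : ZMod p) * (j : ZMod p)) : ℂ) = z ^ j := by
    intro j
    rw [hz, ← AddChar.map_nsmul_eq_pow, nsmul_eq_mul, mul_comm]
  simp_rw [e1]
  have hz2 : z = Complex.exp (Complex.I * ((2 * (Real.pi * k / p) : ℝ) : ℂ)) := by
    have := ZMod.stdAddChar_coe (N := p) (k : ℤ)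
    rw [hz]
    rw [Int.cast_natCast] at this
    rw [this]; congr 1; push_cast; ring
  obtain ⟨h1, h2⟩ := fp_sin p k hk hkp
  have hn : ‖z - 1‖ = 2 * Real.sin (Real.pi * k / p) := by
    rw [hz2, Complex.norm_exp_I_mul_ofReal_sub_one]
    rw [Real.norm_eq_abs, mul_div_cancel_left₀ _ (two_ne_zero), abs_of_pos (by positivity)]
  have hz1 : ‖z‖ = 1 := by
    rw [hz2, mul_comm]; exact Complex.norm_exp_ofReal_mul_I _
  refine (fp_geo z hz1 ?_ M).trans ?_
  · intro h; rw [h] at hn; simp at hn; linarith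
  · rw [hn]; rwa [div_mul_eq_div_div, div_self two_ne_zero]

theorem fp_gauss (p : ℕ) [Fact p.Prime] (χ : MulChar (ZMod p) ℂ) (hχ : χ ≠ 1) :
    ‖gaussSum χ (ZMod.stdAddChar (N := p))‖ = Real.sqrt p := by
  have h := gaussSum_mul_gaussSum_eq_card hχ (ZMod.isPrimitive_stdAddChar p)
  rw [← star_gaussSum_eq] at h
  have h2 := congrArg norm h
  rw [norm_mul, norm_star, ZMod.card, Complex.norm_natCast] at h2
  rw [← h2, Real.sqrt_mul_self (norm_nonneg _)]

theorem fp_harm (p : ℕ) (hp : 1 ≤ p) :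
    ∑ k ∈ Finset.Ico 1 p, ((p : ℝ) / 2 * (1 / k + 1 / (p - k : ℕ))) ≤ p * (1 + Real.log p) := by
  rw [← Finset.mul_sum, Finset.sum_add_distrib]
  have h1 : ∑ k ∈ Finset.Ico 1 p, (1 : ℝ) / (p - k : ℕ) = ∑ k ∈ Finset.Ico 1 p, (1 : ℝ) / k := by
    refine Finset.sum_nbij' (fun k => p - k) (fun k => p - k) ?_ ?_ ?_ ?_ ?_ <;>
      intro k hk <;> simp at hk ⊢ <;> omega
  have h2 : ∑ k ∈ Finset.Ico 1 p, (1 : ℝ) / k ≤ 1 + Real.log p := by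
    have := harmonic_le_one_add_log p
    refine le_trans ?_ this
    rw [harmonic_eq_sum_Icc]
    push_cast
    simp_rw [one_div]
    refine Finset.sum_le_sum_of_subset_of_nonneg ?_ (fun _ _ _ => by positivity)
    intro k; simp; omega
  rw [h1]
  have : (0 : ℝ) ≤ p := by positivity
  nlinarith

theorem fp_pv (p : ℕ) [hp : Fact p.Prime] (χ : MulChar (ZMod p) ℂ) (hχ : χ ≠ 1) (M : ℕ) :
    ‖∑ j ∈ Finset.range M, χ (j : ZMod p)‖ ≤ Real.sqrt p * (1 + Real.log p) := by
  have hχ' : χ⁻¹ ≠ 1 := by simpa using hχ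
  set G := gaussSum χ⁻¹ (ZMod.stdAddChar (N := p)) with hG
  have hGn : ‖G‖ = Real.sqrt p := fp_gauss p χ⁻¹ hχ'
  have hp0 : (0 : ℝ) < p := by exact_mod_cast hp.out.pos
  have key : ∀ j : ZMod p, G * χ j = ∑ a : ZMod p, χ⁻¹ a * ZMod.stdAddChar (a * j) := by
    intro j
    by_cases hj : j = 0
    · subst hj
      simp only [mul_zero, AddChar.map_zero_eq_one, mul_one]
      rw [MulChar.sum_eq_zero_of_ne_one hχ', MulChar.map_zero, mul_zero]
    · have := gaussSum_mulShift_eq χ⁻¹ (ZMod.stdAddChar (N := p)) (Units.mk0 j hj)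
      rw [inv_inv, Units.val_mk0] at this
      rw [mul_comm, hG, ← this, gaussSum]
      simp_rw [AddChar.mulShift_apply, mul_comm]
  have h1 : G * ∑ j ∈ Finset.range M, χ (j : ZMod p) =
      ∑ a : ZMod p, χ⁻¹ a * ∑ j ∈ Finset.range M, ZMod.stdAddChar (a * (j : ZMod p)) := by
    rw [Finset.mul_sum]
    simp_rw [key, Finset.mul_sum]
    rw [Finset.sum_comm]
  have h2 : ‖G * ∑ j ∈ Finset.range M, χ (j : ZMod p)‖ ≤ p * (1 + Real.log p) := by
    rw [h1]
    refine le_trans ?_ (fp_harm p hp.out.one_le)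
    have h3 : ∑ a : ZMod p, χ⁻¹ a * ∑ j ∈ Finset.range M, (ZMod.stdAddChar (a * (j : ZMod p)) : ℂ)
       = ∑ k ∈ Finset.Ico 1 p, χ⁻¹ (k : ZMod p) *
          ∑ j ∈ Finset.range M, (ZMod.stdAddChar ((k : ZMod p) * (j : ZMod p)) : ℂ) := by
      symm
      apply Finset.sum_bij_ne_zero (fun (k : ℕ) _ _ => (k : ZMod p))
      · intros; simp
      · intro a ha _ b hb _ hab
        simp at ha hb
        have := congrArg ZMod.val hab
        rwa [ZMod.val_natCast_of_lt ha.2, ZMod.val_natCast_of_lt hb.2] at this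
      · intro b _ hb
        have hb0 : b ≠ 0 := by
          rintro rfl
          simp [MulChar.map_zero] at hb
        refine ⟨b.val, ?_, ?_, ?_⟩
        · simp
          exact ⟨Nat.one_le_iff_ne_zero.mpr (by simpa using hb0), ZMod.val_lt b⟩
        · simpa using hb
        · simp
      · intros; rfl
    rw [h3]
    refine (norm_sum_le _ _).trans (Finset.sum_le_sum fun k hk => ?_)
    simp only [Finset.mem_Ico] at hk
    rw [norm_mul]
    calc _ ≤ 1 * ‖∑ j ∈ Finset.range M, (ZMod.stdAddChar ((k : ZMod p) * (j : ZMod p)) : ℂ)‖ := by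
          gcongr
          exact DirichletCharacter.norm_le_one _ _
      _ ≤ _ := by rw [one_mul]; exact fp_psi p k hk.1 hk.2 M
  rw [norm_mul, hGn] at h2
  have hs : 0 < Real.sqrt p := Real.sqrt_pos.mpr hp0
  refine le_of_mul_le_mul_left ?_ hs
  calc _ ≤ _ := h2
    _ = _ := by rw [← mul_assoc, Real.mul_self_sqrt hp0.le]

open ArithmeticFunction in
theorem fp_mob (m : ℕ) (_hm : m ≠ 0) :
    ∑ d ∈ m.divisors, ((moebius d : ℤ) : ℂ) = if m = 1 then 1 else 0 := by
  have h := congrArg (fun f : ArithmeticFunction ℤ => f m) coe_zeta_mul_moebius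
  simp only [coe_zeta_mul_apply, one_apply] at h
  rw [← Int.cast_sum, h]; split_ifs <;> simp

open ArithmeticFunction in
theorem fp_tot (n : ℕ) (hn : n ≠ 0) :
    ∑ d ∈ n.divisors, ((moebius d : ℤ) : ℂ) / d = (n.totient : ℂ) / n := by
  have h := (sum_eq_iff_sum_mul_moebius_eq (R := ℂ) (f := fun n => (n.totient : ℂ))
    (g := fun n => (n : ℂ))).1 (by
      intro m _
      rw [← Nat.cast_sum, Nat.sum_totient]) n (Nat.pos_of_ne_zero hn)
  rw [Nat.sum_divisorsAntidiagonal (f := fun a b => ((moebius a : ℤ) : ℂ) * (b : ℂ))] at h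
  rw [← h, Finset.sum_div]
  refine Finset.sum_congr rfl fun d hd => ?_
  have hd' := Nat.dvd_of_mem_divisors hd
  have hd0 : (d : ℂ) ≠ 0 := by exact_mod_cast (Nat.pos_of_mem_divisors hd).ne'
  have hn0 : (n : ℂ) ≠ 0 := by exact_mod_cast hn
  rw [Nat.cast_div hd' hd0]
  field_simp

open ArithmeticFunction in
theorem fp_moebius_norm (d : ℕ) : ‖((moebius d : ℤ) : ℂ)‖ ≤ 1 := by
  rw [Complex.norm_intCast]
  exact_mod_cast (abs_moebius_le_one (n := d))

open ArithmeticFunction in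
theorem fp_cop (n : ℕ) (hn : n ≠ 0) (f : ℕ → ℂ) (hf0 : f 0 = 0)
    (hf1 : ∀ a b, f (a * b) = f a * f b) (hf : ∀ a, ‖f a‖ ≤ 1) (B : ℝ) (hB0 : 0 ≤ B)
    (hB : ∀ M, ‖∑ j ∈ Finset.range M, f j‖ ≤ B) :
    ‖∑ h ∈ (Finset.Ico 1 (1 + n)).filter n.Coprime, f h‖ ≤ n.divisors.card * B := by
  have h1 : ∑ h ∈ (Finset.Ico 1 (1 + n)).filter n.Coprime, f h =
      ∑ e ∈ n.divisors, ((moebius e : ℤ) : ℂ) *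
        (f e * ∑ j ∈ Finset.range (n / e + 1), f j) := by
    have a1 : ∀ h ∈ Finset.Ico 1 (1 + n), (if n.Coprime h then f h else 0) =
        ∑ e ∈ n.divisors, if e ∣ h then ((moebius e : ℤ) : ℂ) * f h else 0 := by
      intro h hh
      simp only [Finset.mem_Ico] at hh
      rw [← Finset.sum_filter, ← Finset.sum_mul]
      have : n.divisors.filter (· ∣ h) = (n.gcd h).divisors := by
        ext e
        simp [Nat.dvd_gcd_iff, hn]
      rw [this, fp_mob _ (Nat.gcd_pos_of_pos_left _ (Nat.pos_of_ne_zero hn)).ne']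
      unfold Nat.Coprime
      split_ifs <;> simp
    rw [Finset.sum_filter, Finset.sum_congr rfl a1, Finset.sum_comm]
    refine Finset.sum_congr rfl fun e he => ?_
    have he0 := Nat.pos_of_mem_divisors he
    rw [← Finset.sum_filter, ← Finset.mul_sum]
    congr 1
    rw [Finset.mul_sum]
    simp_rw [← hf1]
    symm
    apply Finset.sum_bij_ne_zero (fun j _ _ => e * j)
    · intro j hj hne
      have : j ≠ 0 := by rintro rfl; simp [hf0] at hne
      simp only [Finset.mem_range, Finset.mem_filter, Finset.mem_Ico] at hj ⊢
      have h3 : e * j ≤ n := by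
        rw [mul_comm]; exact (Nat.le_div_iff_mul_le he0).1 (by omega)
      have : 0 < e * j := by positivity
      exact ⟨⟨by omega, by omega⟩, dvd_mul_right _ _⟩
    · intro a _ _ b _ _ hab
      exact Nat.eq_of_mul_eq_mul_left he0 hab
    · intro b hb hne
      simp only [Finset.mem_filter, Finset.mem_Ico] at hb
      obtain ⟨c, rfl⟩ := hb.2
      refine ⟨c, ?_, hne, rfl⟩
      simp only [Finset.mem_range]
      have : c ≤ n / e := (Nat.le_div_iff_mul_le he0).2 (by rw [mul_comm]; omega)
      omega
    · intros; rfl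
  rw [h1, ← nsmul_eq_mul]
  refine (norm_sum_le _ _).trans (Finset.sum_le_card_nsmul _ _ _ fun e _ => ?_)
  rw [norm_mul, norm_mul]
  calc _ ≤ 1 * (1 * B) := by
        gcongr
        · exact fp_moebius_norm e
        · exact hf e
        · exact hB _
    _ = B := by ring

open ArithmeticFunction in
theorem fp_pr (n : ℕ) (hn : n ≠ 0) (z : ℂ) (hz : z ^ n = 1) :
    ∑ d ∈ n.divisors, ((moebius d : ℤ) : ℂ) / d * ∑ j ∈ Finset.range d, z ^ (n / d * j) =
      if orderOf z = n then 1 else 0 := by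
  have hdvd : orderOf z ∣ n := orderOf_dvd_of_pow_eq_one hz
  obtain ⟨m, hm⟩ := hdvd
  have hm0 : m ≠ 0 := by rintro rfl; simp at hm; exact hn hm
  have ho0 : 0 < orderOf z := Nat.pos_of_ne_zero (by intro h; rw [h] at hm; simp at hm; exact hn hm)
  have a1 : ∀ d ∈ n.divisors,
      ((moebius d : ℤ) : ℂ) / d * ∑ j ∈ Finset.range d, z ^ (n / d * j) =
      if d ∣ m then ((moebius d : ℤ) : ℂ) else 0 := by
    intro d hd
    have hd' := Nat.dvd_of_mem_divisors hd
    have hd0 : (d : ℂ) ≠ 0 := by exact_mod_cast (Nat.pos_of_mem_divisors hd).ne'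
    have hiff : d ∣ m ↔ z ^ (n / d) = 1 := by
      rw [← orderOf_dvd_iff_pow_eq_one, Nat.dvd_div_iff_mul_dvd hd', mul_comm d]
      conv_rhs => rw [hm]
      exact (Nat.mul_dvd_mul_iff_left ho0).symm
    simp_rw [pow_mul]
    split_ifs with h
    · rw [hiff.1 h]; simp; field_simp
    · rw [geom_sum_eq (fun h' => h (hiff.2 h')), ← pow_mul, Nat.div_mul_cancel hd', hz]
      simp
  rw [Finset.sum_congr rfl a1, ← Finset.sum_filter]
  have : n.divisors.filter (· ∣ m) = m.divisors := by
    ext e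
    simp only [Finset.mem_filter, Nat.mem_divisors]
    constructor
    · intro h; exact ⟨h.2, hm0⟩
    · intro h; exact ⟨⟨h.1.trans (hm ▸ dvd_mul_left _ _), hn⟩, h.1⟩
  rw [this, fp_mob m hm0]
  have : m = 1 ↔ orderOf z = n := by
    constructor
    · rintro rfl; simpa using hm.symm
    · intro h; rw [h] at hm
      exact Nat.eq_of_mul_eq_mul_left (Nat.pos_of_ne_zero hn) (by omega)
  simp only [this]

theorem fp_char (p : ℕ) [hp : Fact p.Prime] : ∃ χ : MulChar (ZMod p) ℂ, orderOf χ = p - 1 ∧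
    ∀ a : (ZMod p)ˣ, orderOf (χ a) = orderOf (a : ZMod p) := by
  have hn : p - 1 ≠ 0 := by have := hp.out.two_le; omega
  obtain ⟨χ, hχ⟩ := MulChar.exists_mulChar_orderOf (ZMod p) (n := p - 1) (by rw [ZMod.card])
    (Complex.isPrimitiveRoot_exp (p - 1) hn)
  refine ⟨χ, hχ, fun a => ?_⟩
  obtain ⟨g, hg⟩ := IsCyclic.exists_generator (α := (ZMod p)ˣ)
  have hinj : ∀ b : (ZMod p)ˣ, χ b = 1 → b = 1 := by
    intro b hb
    obtain ⟨k, rfl⟩ := (mem_powers_iff_mem_zpowers).2 (hg b)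
    simp only at hb ⊢
    have h1 : χ ^ k = 1 := by
      refine MulChar.ext fun c => ?_
      obtain ⟨l, rfl⟩ := (mem_powers_iff_mem_zpowers).2 (hg c)
      rw [MulChar.pow_apply_coe, MulChar.one_apply_coe]
      simp only [Units.val_pow_eq_pow_val, map_pow] at hb ⊢
      rw [← pow_mul, mul_comm, pow_mul, hb, one_pow]
    have h2 := orderOf_dvd_of_pow_eq_one h1
    rw [hχ] at h2
    obtain ⟨c, rfl⟩ := h2
    rw [pow_mul, ZMod.units_pow_card_sub_one_eq_one, one_pow]
  rw [orderOf_eq_orderOf_iff]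
  intro k
  constructor
  · intro h
    have := hinj (a ^ k) (by rw [Units.val_pow_eq_pow_val, map_pow, h])
    rw [← Units.val_pow_eq_pow_val, this, Units.val_one]
  · intro h
    rw [← map_pow, h, map_one]

theorem fp_inv (n h : ℕ) (hn : n ≠ 0) (hc : h.Coprime n) : ∃ k, k.Coprime n ∧ h * k ≡ 1 [MOD n] := by
  have h1 := Nat.ModEq.pow_totient hc
  have h2 : 0 < n.totient := Nat.totient_pos.2 (Nat.pos_of_ne_zero hn)
  refine ⟨h ^ (n.totient - 1), Nat.Coprime.pow_left _ hc, ?_⟩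
  rwa [← pow_succ', Nat.sub_add_cancel h2]

theorem fp_powmod {R : Type*} [Monoid R] (n k : ℕ) (x : R) (hx : x ^ n = 1) (hk : k ≡ 1 [MOD n]) :
    x ^ k = x := by
  have := (pow_eq_pow_of_modEq (x := x) hk hx)
  rwa [pow_one] at this

theorem fp_card (p : ℕ) [hp : Fact p.Prime] :
    Nat.card {gh : ℕ × ℕ // 1 ≤ gh.1 ∧ gh.1 ≤ p - 1 ∧ 1 ≤ gh.2 ∧ gh.2 ≤ p - 1 ∧
        gh.1 ^ gh.2 ≡ gh.2 [MOD p] ∧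
        IsPrimitiveRoot (gh.1 : ZMod p) (p - 1) ∧
        IsPrimitiveRoot (gh.2 : ZMod p) (p - 1) ∧
        Nat.gcd gh.2 (p - 1) = 1} =
    (((Finset.Ico 1 (1 + (p - 1))).filter (p - 1).Coprime).filter
      (fun h : ℕ => orderOf (h : ZMod p) = p - 1)).card := by
  have h2 := hp.out.two_le
  have hn : p - 1 ≠ 0 := by omega
  rw [← Nat.card_eq_finsetCard]
  have hmem : ∀ h : ℕ, h ∈ (((Finset.Ico 1 (1 + (p - 1))).filter (p - 1).Coprime).filter
      (fun h : ℕ => orderOf (h : ZMod p) = p - 1)) ↔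
      1 ≤ h ∧ h ≤ p - 1 ∧ IsPrimitiveRoot (h : ZMod p) (p - 1) ∧ Nat.gcd h (p - 1) = 1 := by
    intro h
    rw [Finset.mem_filter, Finset.mem_filter, Finset.mem_Ico, Nat.coprime_comm,
      IsPrimitiveRoot.iff_orderOf]
    unfold Nat.Coprime
    constructor
    · rintro ⟨⟨⟨a, b⟩, c⟩, d⟩
      exact ⟨a, by omega, d, c⟩
    · rintro ⟨a, b, d, c⟩
      exact ⟨⟨⟨a, by omega⟩, c⟩, d⟩
  refine Nat.card_eq_of_bijective
    (fun x => ⟨x.1.2, (hmem _).2 ⟨x.2.2.2.1, x.2.2.2.2.1, x.2.2.2.2.2.2.2.1, x.2.2.2.2.2.2.2.2⟩⟩)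
    ⟨?_, ?_⟩
  · rintro ⟨⟨g, h⟩, a1, a2, a3, a4, a5, a6, a7, a8⟩ ⟨⟨g', h'⟩, b1, b2, b3, b4, b5, b6, b7, b8⟩ heq
    simp only [Subtype.mk.injEq] at heq a1 a2 a3 a4 a5 a6 a7 a8 b1 b2 b3 b4 b5 b6 b7 b8
    subst heq
    obtain ⟨k, -, hk⟩ := fp_inv (p - 1) h hn a8
    have e1 : (g : ZMod p) ^ h = (g' : ZMod p) ^ h := by
      have := (ZMod.natCast_eq_natCast_iff _ _ _).2 (a5.trans b5.symm)
      push_cast at this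
      exact this
    have e2 : (g : ZMod p) = g' := by
      rw [← fp_powmod (p - 1) (h * k) (g : ZMod p) a6.pow_eq_one hk,
        ← fp_powmod (p - 1) (h * k) (g' : ZMod p) b6.pow_eq_one hk, pow_mul, pow_mul, e1]
    have e3 := congrArg ZMod.val e2
    rw [ZMod.val_natCast_of_lt (by omega), ZMod.val_natCast_of_lt (by omega)] at e3
    subst e3
    rfl
  · rintro ⟨h, hh⟩
    obtain ⟨c1, c2, c3, c4⟩ := (hmem h).1 hh
    obtain ⟨k, hkc, hk⟩ := fp_inv (p - 1) h hn c4
    have hg : IsPrimitiveRoot ((h : ZMod p) ^ k) (p - 1) := c3.pow_of_coprime k hkc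
    have hg0 : (h : ZMod p) ^ k ≠ 0 := hg.ne_zero hn
    refine ⟨⟨(((h : ZMod p) ^ k).val, h), ?_, ?_, c1, c2, ?_, ?_, c3, c4⟩, rfl⟩
    · exact Nat.one_le_iff_ne_zero.mpr (by rwa [Ne, ZMod.val_eq_zero])
    · have := ZMod.val_lt ((h : ZMod p) ^ k)
      simp only
      omega
    · rw [← ZMod.natCast_eq_natCast_iff]
      push_cast
      rw [ZMod.natCast_zmod_val, ← pow_mul, mul_comm]
      exact fp_powmod (p - 1) _ _ c3.pow_eq_one hk
    · simp only [ZMod.natCast_zmod_val]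
      exact hg

/-- Theorem (Cobeli–Zaharescu / Zhang): for a prime `p`, the number of pairs `(g,h)` with
`1 ≤ g,h ≤ p-1`, `g^h ≡ h (mod p)`, `g` a primitive root mod `p`, and `h` a primitive root
mod `p` with `gcd(h,p-1) = 1` differs from `φ(p-1)²/(p-1)` by at most
`d(p-1)² √p (1 + ln p)`. -/
theorem fixed_points_gPR_hRPPR (p : ℕ) (hp : p.Prime) :
    |(Nat.card {gh : ℕ × ℕ // 1 ≤ gh.1 ∧ gh.1 ≤ p - 1 ∧ 1 ≤ gh.2 ∧ gh.2 ≤ p - 1 ∧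
        gh.1 ^ gh.2 ≡ gh.2 [MOD p] ∧
        IsPrimitiveRoot (gh.1 : ZMod p) (p - 1) ∧
        IsPrimitiveRoot (gh.2 : ZMod p) (p - 1) ∧
        Nat.gcd gh.2 (p - 1) = 1} : ℝ) -
      ((p - 1).totient : ℝ) ^ 2 / ((p - 1 : ℕ) : ℝ)| ≤
    ((p - 1).divisors.card : ℝ) ^ 2 * Real.sqrt p * (1 + Real.log p) := by
  haveI : Fact p.Prime := ⟨hp⟩
  rw [fp_card p]
  obtain ⟨χ, hχ, hord⟩ := fp_char p
  have h2 := hp.two_le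
  have hn : p - 1 ≠ 0 := by omega
  set n := p - 1 with hn_def
  set T := (Finset.Ico 1 (1 + n)).filter n.Coprime with hT
  set B := Real.sqrt p * (1 + Real.log p) with hB
  have hlog : 0 ≤ Real.log p := Real.log_natCast_nonneg p
  have hB0 : 0 ≤ B := by positivity
  have hTu : ∀ h ∈ T, IsUnit (h : ZMod p) := by
    intro h hh
    rw [hT, Finset.mem_filter, Finset.mem_Ico] at hh
    rw [isUnit_iff_ne_zero, Ne, ZMod.natCast_eq_zero_iff]
    intro hd
    have := Nat.le_of_dvd (by omega) hd
    omega
  have hTc : T.card = n.totient := Nat.filter_coprime_Ico_eq_totient n 1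
  let S : MulChar (ZMod p) ℂ → ℂ := fun ψ => ∑ h ∈ T, ψ (h : ZMod p)
  have hS1 : S 1 = n.totient := by
    change ∑ h ∈ T, (1 : MulChar (ZMod p) ℂ) (h : ZMod p) = _
    rw [Finset.sum_congr rfl fun h hh => MulChar.one_apply (hTu h hh)]
    simp [hTc]
  have hSb : ∀ ψ : MulChar (ZMod p) ℂ, ψ ≠ 1 → ‖S ψ‖ ≤ n.divisors.card * B := by
    intro ψ hψ
    refine fp_cop n hn (fun j : ℕ => ψ (j : ZMod p)) (by simp [MulChar.map_zero]) (by simp)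
      (fun a => DirichletCharacter.norm_le_one _ _) B hB0 (fun M => fp_pv p ψ hψ M)
  have hN : (((T.filter (fun h : ℕ => orderOf (h : ZMod p) = n)).card : ℕ) : ℂ) =
      ∑ d ∈ n.divisors, ((ArithmeticFunction.moebius d : ℤ) : ℂ) / d * ∑ j ∈ Finset.range d, S (χ ^ (n / d * j)) := by
    have e1 : ∀ h ∈ T, (if orderOf (h : ZMod p) = n then (1 : ℂ) else 0) =
        ∑ d ∈ n.divisors, ((ArithmeticFunction.moebius d : ℤ) : ℂ) / d *
          ∑ j ∈ Finset.range d, (χ ^ (n / d * j)) (h : ZMod p) := by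
      intro h hh
      obtain ⟨u, hu⟩ := hTu h hh
      rw [← hu, ← hord u]
      rw [← fp_pr n hn (χ u) (by
        rw [← map_pow, ← Units.val_pow_eq_pow_val, ZMod.units_pow_card_sub_one_eq_one]; simp)]
      simp_rw [MulChar.pow_apply_coe]
    rw [Finset.card_filter]
    push_cast
    rw [Finset.sum_congr rfl e1, Finset.sum_comm]
    refine Finset.sum_congr rfl fun d _ => ?_
    rw [← Finset.mul_sum, Finset.sum_comm]
  have hdiff : (((T.filter (fun h : ℕ => orderOf (h : ZMod p) = n)).card : ℕ) : ℂ) -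
      (n.totient : ℂ) ^ 2 / n =
      ∑ d ∈ n.divisors, ((ArithmeticFunction.moebius d : ℤ) : ℂ) / d * ∑ j ∈ Finset.Ico 1 d, S (χ ^ (n / d * j)) := by
    have e2 : (n.totient : ℂ) ^ 2 / n =
        ∑ d ∈ n.divisors, ((ArithmeticFunction.moebius d : ℤ) : ℂ) / d * n.totient := by
      rw [← Finset.sum_mul, fp_tot n hn]; ring
    rw [hN, e2, ← Finset.sum_sub_distrib]
    refine Finset.sum_congr rfl fun d hd => ?_
    have hd0 := Nat.pos_of_mem_divisors hd
    rw [Finset.range_eq_Ico, Finset.sum_eq_sum_Ico_succ_bot hd0, mul_zero, pow_zero, hS1]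
    ring
  have hfin : ‖(((T.filter (fun h : ℕ => orderOf (h : ZMod p) = n)).card : ℕ) : ℂ) -
      (n.totient : ℂ) ^ 2 / n‖ ≤ n.divisors.card * (n.divisors.card * B) := by
    rw [hdiff, ← nsmul_eq_mul]
    refine (norm_sum_le _ _).trans (Finset.sum_le_card_nsmul _ _ _ fun d hd => ?_)
    have hd0 := Nat.pos_of_mem_divisors hd
    have hdn := Nat.dvd_of_mem_divisors hd
    have hd0' : (0 : ℝ) < d := by exact_mod_cast hd0
    have e3 : ‖∑ j ∈ Finset.Ico 1 d, S (χ ^ (n / d * j))‖ ≤ d * (n.divisors.card * B) := by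
      refine (norm_sum_le _ _).trans ?_
      refine (Finset.sum_le_card_nsmul _ _ (n.divisors.card * B) fun j hj => ?_).trans ?_
      · rw [Finset.mem_Ico] at hj
        refine hSb _ fun h1 => ?_
        have h3 := orderOf_dvd_of_pow_eq_one h1
        rw [hχ] at h3
        have h4 : 0 < n / d := Nat.div_pos (Nat.le_of_dvd (by omega) hdn) hd0
        have h5 := Nat.le_of_dvd (Nat.mul_pos h4 (by omega)) h3
        have h6 : n / d * j < n / d * d := Nat.mul_lt_mul_of_pos_left hj.2 h4
        rw [Nat.div_mul_cancel hdn] at h6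
        omega
      · rw [nsmul_eq_mul, Nat.card_Ico]
        gcongr
        exact Nat.sub_le _ _
    rw [norm_mul, norm_div, Complex.norm_natCast]
    calc _ ≤ 1 / (d : ℝ) * (d * (n.divisors.card * B)) := by
          gcongr
          exact fp_moebius_norm d
      _ = _ := by field_simp
  calc _ = ‖(((T.filter (fun h : ℕ => orderOf (h : ZMod p) = n)).card : ℕ) : ℂ) -
      (n.totient : ℂ) ^ 2 / n‖ := by
        rw [← Real.norm_eq_abs, ← Complex.norm_real]
        push_cast
        rfl
    _ ≤ _ := hfin
    _ = _ := by rw [hB]; ring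
end

section
/- Let p be a prime. Then the number G_{g ANY, h ANY}(p) of integers h with 1 ≤ h ≤ p-1 for which there exists some g with 1 ≤ g ≤ p-1 and g^h ≡ h (mod p) satisfies |G_{g ANY, h ANY}(p) − Σ_{e | p-1} (1/e) · φ((p-1)/e)| ≤ d(p-1)² · √p · (1 + ln p), where the sum runs over the positive divisors e of p-1. -/
lemma sin_lower {x : ℝ} (h0 : 0 < x) (h1 : x < 1) : 2 * (x * (1 - x)) ≤ Real.sin (Real.pi * x) := by
  have hpi := Real.pi_pos
  rcases le_total x (1/2) with h | h
  · have := Real.mul_le_sin (x := Real.pi * x) (by positivity) (by nlinarith)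
    have e : 2 / Real.pi * (Real.pi * x) = 2 * x := by field_simp
    nlinarith
  · have := Real.mul_le_sin (x := Real.pi * (1 - x)) (by nlinarith) (by nlinarith)
    have e : 2 / Real.pi * (Real.pi * (1 - x)) = 2 * (1 - x) := by field_simp
    have e2 : Real.sin (Real.pi * (1 - x)) = Real.sin (Real.pi * x) := by
      rw [← Real.sin_pi_sub]; congr 1; ring
    rw [e, e2] at this
    nlinarith

lemma geom_bound (p : ℕ) [Fact p.Prime] (j : ℕ) (hj : 0 < j) (hjp : j < p) (N : ℕ) :
    ‖∑ k ∈ Finset.Icc 1 N, (ZMod.stdAddChar (j : ZMod p)) ^ k‖ ≤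
      (p / 2 : ℝ) * (1 / (j : ℝ) + 1 / ((p - j : ℕ) : ℝ)) := by
  set z : ℂ := ZMod.stdAddChar (j : ZMod p) with hz
  have hp0 : (0 : ℝ) < p := by exact_mod_cast (lt_trans hj hjp)
  have hj0 : (0 : ℝ) < j := by exact_mod_cast hj
  have hjp' : (j : ℝ) < p := by exact_mod_cast hjp
  have hze : z = Complex.exp (Complex.I * ((2 * Real.pi * (j / p) : ℝ) : ℂ)) := by
    have := ZMod.stdAddChar_coe (N := p) (j : ℤ)
    rw [hz]
    push_cast at this ⊢
    rw [this]; congr 1; ring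
  have hx0 : (0 : ℝ) < j / p := by positivity
  have hx1 : (j : ℝ) / p < 1 := by rw [div_lt_one hp0]; exact hjp'
  have hs := sin_lower hx0 hx1
  have hpos : 0 < (j : ℝ) / p * (1 - j / p) := mul_pos hx0 (by linarith)
  have hz1 : 2 * (2 * ((j : ℝ) / p * (1 - j / p))) ≤ ‖z - 1‖ := by
    rw [hze, Complex.norm_exp_I_mul_ofReal_sub_one, Real.norm_eq_abs]
    refine le_trans ?_ (le_abs_self _)
    have : 2 * Real.pi * ((j : ℝ) / p) / 2 = Real.pi * (j / p) := by ring
    rw [this]; linarith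
  have hzn : ‖z‖ = 1 := by rw [hze, Complex.norm_exp_I_mul_ofReal]
  have hne : z ≠ 1 := by
    intro h
    rw [h] at hz1; simp at hz1; linarith
  have hsum : ∑ k ∈ Finset.Icc 1 N, z ^ k = (z ^ (N + 1) - z) / (z - 1) := by
    have := geom_sum_Ico hne (m := 1) (n := N + 1) (by omega)
    rw [pow_one] at this
    rw [← this]; rfl
  rw [hsum, norm_div]
  have hnum : ‖z ^ (N + 1) - z‖ ≤ 2 := by
    refine (norm_sub_le _ _).trans ?_
    rw [norm_pow, hzn]; norm_num
  have : (p / 2 : ℝ) * (1 / (j : ℝ) + 1 / ((p - j : ℕ) : ℝ)) = 2 / (2 * (2 * ((j : ℝ) / p * (1 - j / p)))) := by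
    rw [Nat.cast_sub hjp.le]
    have : (p : ℝ) - j ≠ 0 := by linarith
    have h3 : 1 - (j : ℝ) / p = (p - j) / p := by field_simp
    rw [h3]
    field_simp
    ring
  rw [this]
  exact div_le_div₀ (by norm_num) hnum (by positivity) hz1

lemma sum_recip (p : ℕ) (hp : 1 ≤ p) :
    ∑ j ∈ Finset.Ico 1 p, (p / 2 : ℝ) * (1 / (j : ℝ) + 1 / ((p - j : ℕ) : ℝ)) ≤ p * (1 + Real.log p) := by
  have h1 : ∑ j ∈ Finset.Ico 1 p, 1 / (j : ℝ) ≤ 1 + Real.log p := by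
    refine le_trans ?_ (harmonic_le_one_add_log p)
    rw [harmonic_eq_sum_Icc]
    push_cast
    simp only [one_div]
    refine Finset.sum_le_sum_of_subset_of_nonneg ?_ (fun _ _ _ => by positivity)
    intro x hx; simp at hx ⊢; omega
  have h2 : ∑ j ∈ Finset.Ico 1 p, 1 / ((p - j : ℕ) : ℝ) = ∑ j ∈ Finset.Ico 1 p, 1 / (j : ℝ) := by
    refine Finset.sum_nbij' (fun j => p - j) (fun j => p - j) ?_ ?_ ?_ ?_ ?_ <;>
      (intro a ha; simp at ha ⊢) <;> omega
  rw [← Finset.mul_sum, Finset.sum_add_distrib, h2]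
  have : (0:ℝ) ≤ p := by positivity
  nlinarith

lemma polya_vinogradov (p : ℕ) [Fact p.Prime] (χ : MulChar (ZMod p) ℂ) (hχ : χ ≠ 1) (N : ℕ)
    (hN : N < p) :
    ‖∑ k ∈ Finset.Icc 1 N, χ (k : ZMod p)‖ ≤ Real.sqrt p * (1 + Real.log p) := by
  have hp : p.Prime := Fact.out
  have hp0 : (0 : ℝ) < p := by exact_mod_cast hp.pos
  set ψ : AddChar (ZMod p) ℂ := ZMod.stdAddChar with hψ
  set τ := gaussSum χ⁻¹ ψ with hτ
  have hχ' : χ⁻¹ ≠ 1 := by simpa using hχ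
  have hτn : ‖τ‖ = Real.sqrt p := by
    have h := gaussSum_mul_gaussSum_eq_card hχ' (ZMod.isPrimitive_stdAddChar p)
    rw [← star_gaussSum_eq, ← hψ, ← hτ, ZMod.card] at h
    have h2 := congrArg norm h
    rw [norm_mul, norm_star] at h2
    rw [eq_comm, Real.sqrt_eq_iff_mul_self_eq hp0.le (norm_nonneg _), h2]
    simp
  have key : (∑ k ∈ Finset.Icc 1 N, χ (k : ZMod p)) * τ =
      ∑ a : ZMod p, χ⁻¹ a * ∑ k ∈ Finset.Icc 1 N, (ψ a) ^ k := by
    rw [Finset.sum_mul]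
    simp_rw [Finset.mul_sum]
    rw [Finset.sum_comm]
    refine Finset.sum_congr rfl fun k hk => ?_
    simp at hk
    have hk0 : (k : ZMod p) ≠ 0 := by
      rw [Ne, ZMod.natCast_eq_zero_iff]
      intro h; have := Nat.le_of_dvd (by omega) h; omega
    have := gaussSum_mulShift_eq χ⁻¹ ψ (Units.mk0 _ hk0)
    rw [inv_inv, Units.val_mk0] at this
    rw [hτ, ← this, gaussSum]
    refine Finset.sum_congr rfl fun a _ => ?_
    rw [AddChar.mulShift_apply, ← nsmul_eq_mul, AddChar.map_nsmul_eq_pow]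
  have hb : ‖(∑ k ∈ Finset.Icc 1 N, χ (k : ZMod p)) * τ‖ ≤ p * (1 + Real.log p) := by
    rw [key]
    refine (norm_sum_le _ _).trans (le_trans ?_ (sum_recip p hp.one_le))
    have hs : ∀ f : ZMod p → ℝ, ∑ a : ZMod p, f a = ∑ j ∈ Finset.range p, f (j : ZMod p) := by
      intro f
      refine Finset.sum_nbij' (fun a => a.val) (fun j => (j : ZMod p)) ?_ ?_ ?_ ?_ ?_
      · intro a _; simpa using ZMod.val_lt a
      · intro a _; simp
      · intro a _; simp
      · intro a ha; simp at ha; exact ZMod.val_cast_of_lt ha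
      · intro a _; simp
    rw [hs, Finset.range_eq_Ico, Finset.sum_eq_sum_Ico_succ_bot hp.pos]
    simp only [Nat.cast_zero, MulChar.map_zero, zero_mul, norm_zero, zero_add]
    refine Finset.sum_le_sum fun j hj => ?_
    simp at hj
    rw [norm_mul]
    have h1 : ‖χ⁻¹ (j : ZMod p)‖ ≤ 1 := DirichletCharacter.norm_le_one _ _
    have h2 := geom_bound p j (by omega) hj.2 N
    calc _ ≤ 1 * ‖∑ k ∈ Finset.Icc 1 N, (ψ (j : ZMod p)) ^ k‖ := by gcongr
      _ ≤ _ := by rw [one_mul]; exact h2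
  rw [norm_mul, hτn] at hb
  have hsq : Real.sqrt p * Real.sqrt p = p := Real.mul_self_sqrt hp0.le
  have hs0 : 0 < Real.sqrt p := Real.sqrt_pos.2 hp0
  refine le_of_mul_le_mul_right (hb.trans_eq ?_) hs0
  rw [← hsq]; simp only [Real.sqrt_mul_self hs0.le]; rw [hsq]; linear_combination (1 + Real.log p) * (-hsq)

lemma moebius_ind (n : ℕ) (hn : n ≠ 0) :
    ∑ d ∈ n.divisors, (ArithmeticFunction.moebius d) = if n = 1 then 1 else 0 := by
  have := ArithmeticFunction.coe_zeta_mul_apply (f := ArithmeticFunction.moebius) (x := n)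
  rw [← this, ArithmeticFunction.coe_zeta_mul_moebius, ArithmeticFunction.one_apply]

lemma gcd_ind (q e h : ℕ) (hq : 0 < q) (he : e ∣ q) :
    (if h.gcd q = e then (1 : ℤ) else 0) =
      ∑ d ∈ (q / e).divisors, if d * e ∣ h then ArithmeticFunction.moebius d else 0 := by
  obtain ⟨M, rfl⟩ := he
  have he0 : 0 < e := Nat.pos_of_mul_pos_right hq
  have hM0 : 0 < M := Nat.pos_of_mul_pos_left hq
  rw [Nat.mul_div_cancel_left M he0]
  by_cases hd : e ∣ h
  · obtain ⟨k, rfl⟩ := hd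
    rw [Nat.gcd_mul_left]
    have h1 : (e * k.gcd M = e) ↔ k.gcd M = 1 := by
      constructor
      · intro h; exact Nat.eq_of_mul_eq_mul_left he0 (by simpa using h)
      · intro h; simp [h]
    simp only [h1]
    rw [← moebius_ind (k.gcd M) (Nat.gcd_pos_of_pos_right _ hM0).ne', ← Finset.sum_filter]
    refine Finset.sum_congr ?_ fun _ _ => rfl
    ext d
    simp only [Nat.mem_divisors, Finset.mem_filter, Nat.dvd_gcd_iff]
    rw [mul_comm d e, Nat.mul_dvd_mul_iff_left he0]
    have : k.gcd M ≠ 0 := (Nat.gcd_pos_of_pos_right _ hM0).ne'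
    have hM1 : M ≠ 0 := hM0.ne'
    tauto
  · rw [if_neg, Finset.sum_eq_zero]
    · intro d _
      rw [if_neg]
      exact fun h' => hd (dvd_trans (dvd_mul_left _ _) h')
    · intro h'
      exact hd (h' ▸ Nat.gcd_dvd_left _ _)

lemma char_sum_bound (p : ℕ) [Fact p.Prime] (χ : MulChar (ZMod p) ℂ) (hχ : χ ≠ 1) (e : ℕ)
    (he : e ∣ p - 1) :
    ‖∑ h ∈ (Finset.Icc 1 (p - 1)).filter (fun h => h.gcd (p - 1) = e), χ (h : ZMod p)‖ ≤
      ((p - 1).divisors.card : ℝ) * (Real.sqrt p * (1 + Real.log p)) := by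
  have hp : p.Prime := Fact.out
  have hq : 0 < p - 1 := by have := hp.two_le; omega
  set q := p - 1 with hqd
  have he0 : 0 < e := Nat.pos_of_dvd_of_pos he hq
  have hlog : 0 ≤ Real.log p := Real.log_natCast_nonneg p
  have h1 : ∑ h ∈ (Finset.Icc 1 q).filter (fun h => h.gcd q = e), χ (h : ZMod p) =
      ∑ d ∈ (q / e).divisors, (ArithmeticFunction.moebius d : ℂ) *
        ∑ h ∈ (Finset.Icc 1 q).filter (fun h => d * e ∣ h), χ (h : ZMod p) := by
    rw [Finset.sum_filter]
    simp_rw [Finset.mul_sum, Finset.sum_filter]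
    rw [Finset.sum_comm]
    refine Finset.sum_congr rfl fun h _ => ?_
    have := congrArg (Int.cast : ℤ → ℂ) (gcd_ind q e h hq he)
    push_cast at this
    rw [← mul_boole, mul_comm, this, Finset.sum_mul]
    refine Finset.sum_congr rfl fun d _ => ?_
    split_ifs <;> simp
  have h2 : ∀ c, 0 < c → ‖∑ h ∈ (Finset.Icc 1 q).filter (fun h => c ∣ h), χ (h : ZMod p)‖ ≤
      Real.sqrt p * (1 + Real.log p) := by
    intro c hc
    have : ∑ h ∈ (Finset.Icc 1 q).filter (fun h => c ∣ h), χ (h : ZMod p) =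
        χ (c : ZMod p) * ∑ k ∈ Finset.Icc 1 (q / c), χ (k : ZMod p) := by
      rw [Finset.mul_sum]
      symm
      refine Finset.sum_nbij (fun k => c * k) ?_ ?_ ?_ ?_
      · intro k hk
        simp only [Finset.mem_Icc, Finset.mem_filter] at hk ⊢
        refine ⟨⟨Nat.mul_pos hc hk.1, ?_⟩, dvd_mul_right _ _⟩
        rw [mul_comm]; exact (Nat.le_div_iff_mul_le hc).1 hk.2
      · intro a _ b _ h
        exact Nat.eq_of_mul_eq_mul_left hc h
      · intro h hh
        simp only [Finset.coe_filter, Finset.mem_Icc, Set.mem_setOf_eq] at hh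
        obtain ⟨⟨ha, hb⟩, k, rfl⟩ := hh
        refine ⟨k, ?_, rfl⟩
        simp only [Finset.coe_Icc, Set.mem_Icc]
        refine ⟨Nat.pos_of_mul_pos_left ha, ?_⟩
        rw [Nat.le_div_iff_mul_le hc, mul_comm]; exact hb
      · intro k _
        push_cast
        rw [map_mul]
    rw [this, norm_mul]
    have hn : ‖χ (c : ZMod p)‖ ≤ 1 := DirichletCharacter.norm_le_one _ _
    have hpv := polya_vinogradov p χ hχ (q / c) (by have := Nat.div_le_self q c; omega)
    calc _ ≤ 1 * ‖∑ k ∈ Finset.Icc 1 (q / c), χ (k : ZMod p)‖ := by gcongr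
      _ ≤ _ := by rw [one_mul]; exact hpv
  rw [h1]
  refine (norm_sum_le _ _).trans ?_
  have h3 : ∀ d ∈ (q / e).divisors, ‖(ArithmeticFunction.moebius d : ℂ) *
        ∑ h ∈ (Finset.Icc 1 q).filter (fun h => d * e ∣ h), χ (h : ZMod p)‖ ≤
        Real.sqrt p * (1 + Real.log p) := by
    intro d hd
    have hd0 := Nat.pos_of_mem_divisors hd
    rw [norm_mul]
    have hm : ‖(ArithmeticFunction.moebius d : ℂ)‖ ≤ 1 := by
      rw [Complex.norm_intCast]
      exact_mod_cast ArithmeticFunction.abs_moebius_le_one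
    calc _ ≤ 1 * ‖∑ h ∈ (Finset.Icc 1 q).filter (fun h => d * e ∣ h), χ (h : ZMod p)‖ := by gcongr
      _ ≤ _ := by rw [one_mul]; exact h2 _ (Nat.mul_pos hd0 he0)
  refine (Finset.sum_le_card_nsmul _ _ _ h3).trans ?_
  rw [nsmul_eq_mul]
  have : (q / e).divisors.card ≤ q.divisors.card :=
    Finset.card_le_card (Nat.divisors_subset_of_dvd hq.ne' (Nat.div_dvd_of_dvd he))
  gcongr

/-- The solvability condition. -/
def Solv (p h : ℕ) : Prop := ∃ g : ℕ, 1 ≤ g ∧ g ≤ p - 1 ∧ g ^ h ≡ h [MOD p]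

lemma solv_iff (p : ℕ) [Fact p.Prime] (h : ℕ) (hh : (h : ZMod p) ≠ 0) :
    Solv p h ↔ ∃ u : (ZMod p)ˣ, u ^ (h.gcd (p - 1)) = Units.mk0 (h : ZMod p) hh := by
  have hp : p.Prime := Fact.out
  have hh0 : h ≠ 0 := by rintro rfl; simp at hh
  have hA : Solv p h ↔ ∃ u : (ZMod p)ˣ, u ^ h = Units.mk0 (h : ZMod p) hh := by
    constructor
    · rintro ⟨g, -, -, hg⟩
      have := (ZMod.natCast_eq_natCast_iff _ _ _).2 hg
      push_cast at this
      have hg0 : (g : ZMod p) ≠ 0 := by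
        intro h0
        rw [h0, zero_pow hh0] at this
        exact hh this.symm
      exact ⟨Units.mk0 _ hg0, by ext; simpa using this⟩
    · rintro ⟨u, hu⟩
      have hu' := congrArg Units.val hu
      have h1 : (u : ZMod p).val ≠ 0 := by
        rw [Ne, ZMod.val_eq_zero]; exact u.ne_zero
      have h2 := ZMod.val_lt (u : ZMod p)
      refine ⟨(u : ZMod p).val, by omega, by omega, ?_⟩
      rw [← ZMod.natCast_eq_natCast_iff]
      push_cast
      simpa using hu'
  rw [hA]
  constructor
  · rintro ⟨u, hu⟩
    refine ⟨u ^ (h / h.gcd (p - 1)), ?_⟩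
    rw [← pow_mul, Nat.div_mul_cancel (Nat.gcd_dvd_left _ _), hu]
  · rintro ⟨u, hu⟩
    refine ⟨u ^ (Nat.gcdA h (p - 1)), ?_⟩
    rw [← hu, ← zpow_natCast u (h.gcd (p - 1)), Nat.gcd_eq_gcd_ab, zpow_add, zpow_mul u ((p - 1 : ℕ) : ℤ),
      zpow_natCast u (p - 1), ZMod.units_pow_card_sub_one_eq_one, one_zpow, mul_one, ← zpow_natCast, ← zpow_mul,
      mul_comm]

lemma exists_char (p : ℕ) [Fact p.Prime] (e : ℕ) (he : e ∣ p - 1) :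
    ∃ χ : MulChar (ZMod p) ℂ, orderOf χ = e ∧
      ∀ v : (ZMod p)ˣ, χ v = 1 ↔ ∃ u : (ZMod p)ˣ, u ^ e = v := by
  have hp : p.Prime := Fact.out
  have hq : 0 < p - 1 := by have := hp.two_le; omega
  have he0 : 0 < e := Nat.pos_of_dvd_of_pos he hq
  obtain ⟨χ, hχ⟩ := MulChar.exists_mulChar_orderOf (ZMod p) (R := ℂ) (n := e)
    (by rw [ZMod.card]; exact he) (Complex.isPrimitiveRoot_exp e he0.ne')
  refine ⟨χ, hχ, fun v => ?_⟩
  constructor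
  · intro hv
    obtain ⟨g, hg⟩ := IsCyclic.exists_generator (α := (ZMod p)ˣ)
    obtain ⟨m, hm⟩ := (mem_powers_iff_mem_zpowers (y := v) (x := g)).2 (hg v)
    simp only at hm
    have h1 : (χ ^ m) = 1 := by
      rw [MulChar.eq_iff hg, MulChar.pow_apply_coe, ← map_pow, ← Units.val_pow_eq_pow_val, hm, hv,
        MulChar.one_apply_coe]
    have h2 := orderOf_dvd_of_pow_eq_one h1
    rw [hχ] at h2
    obtain ⟨k, rfl⟩ := h2
    exact ⟨g ^ k, by rw [← hm, ← pow_mul, mul_comm]⟩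
  · rintro ⟨u, rfl⟩
    rw [Units.val_pow_eq_pow_val, map_pow, ← MulChar.pow_apply_coe, ← hχ, pow_orderOf_eq_one,
      MulChar.one_apply_coe]

lemma card_gcd (q e : ℕ) (he : e ∣ q) :
    ((Finset.Icc 1 q).filter (fun h => h.gcd q = e)).card = (q / e).totient := by
  rw [Nat.totient_div_of_dvd he, Finset.card_filter, Finset.card_filter]
  have h1 := Finset.sum_range_succ (fun h => if q.gcd h = e then 1 else 0) q
  have h2 := Finset.sum_range_succ' (fun h => if q.gcd h = e then 1 else 0) q
  have h3 : ∑ i ∈ Finset.Icc 1 q, (if i.gcd q = e then 1 else 0) =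
      ∑ i ∈ Finset.range q, (if q.gcd (i + 1) = e then 1 else 0) := by
    rw [Finset.range_eq_Ico, Finset.sum_Ico_add' (fun i => if q.gcd i = e then 1 else 0) 0 q 1]
    refine Finset.sum_congr ?_ fun i _ => by rw [Nat.gcd_comm]
    ext i; simp <;> omega
  rw [h3]
  simp only [Nat.gcd_self, Nat.gcd_zero_right] at h1 h2
  omega

open Classical in
lemma local_bound (p : ℕ) [Fact p.Prime] (e : ℕ) (he : e ∣ p - 1) :
    |((((Finset.Icc 1 (p - 1)).filter (fun h => h.gcd (p - 1) = e)).filter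
        (fun h => Solv p h)).card : ℝ) - (1 / (e : ℝ)) * (((p - 1) / e).totient : ℝ)| ≤
      ((p - 1).divisors.card : ℝ) * (Real.sqrt p * (1 + Real.log p)) := by
  have hp : p.Prime := Fact.out
  have hq : 0 < p - 1 := by have := hp.two_le; omega
  have he0 : 0 < e := Nat.pos_of_dvd_of_pos he hq
  have heR : (0 : ℝ) < e := by exact_mod_cast he0
  have hlog : 0 ≤ Real.log p := Real.log_natCast_nonneg p
  obtain ⟨χ, hχ, hpow⟩ := exists_char p e he
  set A := (Finset.Icc 1 (p - 1)).filter (fun h => h.gcd (p - 1) = e) with hA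
  set B := ((p - 1).divisors.card : ℝ) * (Real.sqrt p * (1 + Real.log p)) with hB
  have hB0 : 0 ≤ B := by positivity
  have hnz : ∀ h ∈ A, (h : ZMod p) ≠ 0 := by
    intro h hh
    simp only [hA, Finset.mem_filter, Finset.mem_Icc] at hh
    rw [Ne, ZMod.natCast_eq_zero_iff]
    intro h'; have := Nat.le_of_dvd (by omega) h'; omega
  have hind : ∀ h ∈ A, ∑ j ∈ Finset.range e, (χ ^ j) (h : ZMod p) =
      if Solv p h then (e : ℂ) else 0 := by
    intro h hh
    have h0 := hnz h hh
    have hg : h.gcd (p - 1) = e := by simp only [hA, Finset.mem_filter] at hh; exact hh.2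
    have hs := solv_iff p h h0
    rw [hg, ← hpow, Units.val_mk0] at hs
    have hp1 : ∀ j, (χ ^ j) (h : ZMod p) = χ (h : ZMod p) ^ j := fun j => by
      have := MulChar.pow_apply_coe χ j (Units.mk0 _ h0)
      simpa using this
    simp_rw [hp1, hs]
    split_ifs with h1
    · simp [h1]
    · have := geom_sum_eq h1 e
      rw [this, ← hp1, ← hχ, pow_orderOf_eq_one, MulChar.one_apply (isUnit_iff_ne_zero.2 h0)]
      simp
  have hmain : (e : ℂ) * ((A.filter (fun h => Solv p h)).card : ℂ) =
      ((p - 1) / e).totient + ∑ j ∈ Finset.Ico 1 e, ∑ h ∈ A, (χ ^ j) (h : ZMod p) := by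
    have h1 : ∑ j ∈ Finset.range e, ∑ h ∈ A, (χ ^ j) (h : ZMod p) =
        (e : ℂ) * ((A.filter (fun h => Solv p h)).card : ℂ) := by
      rw [Finset.sum_comm, Finset.sum_congr rfl hind, ← Finset.sum_filter, Finset.sum_const,
        nsmul_eq_mul, mul_comm]
    rw [← h1, Finset.range_eq_Ico, Finset.sum_eq_sum_Ico_succ_bot he0, ← card_gcd _ _ he]
    congr 1
    rw [pow_zero, Finset.sum_congr rfl (fun h hh => MulChar.one_apply (isUnit_iff_ne_zero.2 (hnz h hh)))]
    simp [hA]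
  have hbd : ‖∑ j ∈ Finset.Ico 1 e, ∑ h ∈ A, (χ ^ j) (h : ZMod p)‖ ≤ e * B := by
    refine (norm_sum_le _ _).trans ?_
    refine (Finset.sum_le_card_nsmul _ _ B ?_).trans ?_
    · intro j hj
      simp only [Finset.mem_Ico] at hj
      refine char_sum_bound p (χ ^ j) ?_ e he
      intro h1
      have := Nat.le_of_dvd (by omega) (orderOf_dvd_of_pow_eq_one h1)
      omega
    · rw [nsmul_eq_mul]
      gcongr
      simp
  have hreal : ‖(((e : ℝ) * ((A.filter (fun h => Solv p h)).card : ℝ) -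
      (((p - 1) / e).totient : ℝ) : ℝ) : ℂ)‖ ≤ e * B := by
    push_cast
    rw [hmain, add_sub_cancel_left]
    exact hbd
  rw [Complex.norm_real, Real.norm_eq_abs] at hreal
  have : ((A.filter (fun h => Solv p h)).card : ℝ) - (1 / (e : ℝ)) * (((p - 1) / e).totient : ℝ) =
      ((e : ℝ) * ((A.filter (fun h => Solv p h)).card : ℝ) - (((p - 1) / e).totient : ℝ)) / e := by
    field_simp
  rw [this, abs_div, abs_of_pos heR, div_le_iff₀ heR, mul_comm B]
  exact hreal

/-- For a prime `p`, the number of `h` with `1 ≤ h ≤ p-1` for which there exists `g` with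
`1 ≤ g ≤ p-1` and `g^h ≡ h (mod p)` differs from `Σ_{e ∣ p-1} (1/e) φ((p-1)/e)` by at most
`d(p-1)² √p (1 + ln p)`. -/
theorem G_gANY_hANY (p : ℕ) (hp : p.Prime) :
    |(Nat.card {h : ℕ // 1 ≤ h ∧ h ≤ p - 1 ∧ ∃ g : ℕ, 1 ≤ g ∧ g ≤ p - 1 ∧
        g ^ h ≡ h [MOD p]} : ℝ) -
      ∑ e ∈ (p - 1).divisors, (1 / (e : ℝ)) * (((p - 1) / e).totient : ℝ)| ≤
    ((p - 1).divisors.card : ℝ) ^ 2 * Real.sqrt p * (1 + Real.log p) := by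
  classical
  haveI : Fact p.Prime := ⟨hp⟩
  have hq : 0 < p - 1 := by have := hp.two_le; omega
  have h1 : Nat.card {h : ℕ // 1 ≤ h ∧ h ≤ p - 1 ∧ ∃ g : ℕ, 1 ≤ g ∧ g ≤ p - 1 ∧
        g ^ h ≡ h [MOD p]} = ((Finset.Icc 1 (p - 1)).filter (fun h => Solv p h)).card := by
    refine Nat.subtype_card _ fun h => ?_
    rw [Finset.mem_filter, Finset.mem_Icc, and_assoc]; rfl
  have h2 : ((Finset.Icc 1 (p - 1)).filter (fun h => Solv p h)).card =
      ∑ e ∈ (p - 1).divisors, (((Finset.Icc 1 (p - 1)).filter (fun h => h.gcd (p - 1) = e)).filter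
        (fun h => Solv p h)).card := by
    rw [Finset.card_eq_sum_card_fiberwise (f := fun h => h.gcd (p - 1)) (t := (p - 1).divisors)]
    · refine Finset.sum_congr rfl fun e _ => ?_
      rw [Finset.filter_comm]
    · intro h _
      simpa using ⟨Nat.gcd_dvd_right _ _, hq.ne'⟩
  rw [h1, h2]
  push_cast
  rw [← Finset.sum_sub_distrib]
  refine (Finset.abs_sum_le_sum_abs _ _).trans ?_
  refine (Finset.sum_le_card_nsmul _ _ _
    (fun e he => local_bound p e (Nat.dvd_of_mem_divisors he))).trans_eq ?_
  rw [nsmul_eq_mul]; ring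
end

section
/- Define, for a prime p, w(p) = Σ_{m | p-1} φ(m) · (Σ_{d | (p-1)/m} φ(d·m)/(d·m))², where the outer sum is over positive divisors m of p-1 and the inner sum over positive divisors d of (p-1)/m. Then for every sufficiently large x, 1.444 ≤ (1/π(x)) · Σ_{p ≤ x} w(p)/(p-1) ≤ 3.422, where the sum is over primes p ≤ x and π(x) is the number of primes up to x. -/
section

open MeasureTheory Filter Topology Set

/-- Fejér kernel as a cosine integral. -/
noncomputable def fejK (l u : ℝ) : ℝ := ∫ y in (0:ℝ)..l, (1 - y / l) * (2 * Real.cos (y * u))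

lemma fejK_eq {l u : ℝ} (hl : 0 < l) (hu : u ≠ 0) :
    fejK l u = 2 * (1 - Real.cos (l * u)) / (l * u ^ 2) := by
  unfold fejK
  have hd : ∀ y ∈ Set.uIcc 0 l, HasDerivAt
      (fun y => 2 * ((1 - y / l) * (Real.sin (y * u) / u) - Real.cos (y * u) / (l * u ^ 2)))
      ((1 - y / l) * (2 * Real.cos (y * u))) y := by
    intro y _
    have h1 : HasDerivAt (fun y : ℝ => y * u) u y := by simpa using (hasDerivAt_id y).mul_const u
    have h2 := (h1.sin).div_const u
    have h3 := (h1.cos).div_const (l * u ^ 2)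
    have h4 : HasDerivAt (fun y : ℝ => 1 - y / l) (-(1 / l)) y := by
      simpa using ((hasDerivAt_id y).div_const l).const_sub 1
    have h5 := (((h4.mul h2).sub h3).const_mul 2)
    convert! h5 using 1
    field_simp
    ring
  rw [intervalIntegral.integral_eq_sub_of_hasDerivAt hd]
  · field_simp
    simp
    ring
  · apply Continuous.intervalIntegrable
    fun_prop

lemma fejK_continuous (l : ℝ) : Continuous (fejK l) := by
  unfold fejK
  apply intervalIntegral.continuous_parametric_intervalIntegral_of_continuous' (f := fun u y => (1 - y / l) * (2 * Real.cos (y * u)))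
  fun_prop

lemma fejK_nonneg {l : ℝ} (hl : 0 < l) (u : ℝ) : 0 ≤ fejK l u := by
  rcases eq_or_ne u 0 with rfl | hu
  · unfold fejK
    apply intervalIntegral.integral_nonneg hl.le
    intro y hy
    have : y / l ≤ 1 := by rw [div_le_one hl]; exact hy.2
    simp
    linarith
  · rw [fejK_eq hl hu]
    have := Real.cos_le_one (l * u)
    apply div_nonneg <;> [skip; positivity]
    linarith

lemma fejK_le {l : ℝ} (hl : 0 < l) {u : ℝ} (hu : u ≠ 0) : fejK l u ≤ 4 / l * (u ^ 2)⁻¹ := by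
  rw [fejK_eq hl hu]
  have := Real.neg_one_le_cos (l * u)
  have hu2 : 0 < u ^ 2 := by positivity
  rw [div_mul_eq_mul_div, ← div_eq_mul_inv, div_div, mul_comm (u ^ 2) l]
  apply div_le_div_of_nonneg_right _ (by positivity)
  linarith

lemma fejK_le' {l : ℝ} (hl : 0 < l) (u : ℝ) : fejK l u ≤ 2 * l := by
  unfold fejK
  calc _ ≤ ∫ y in (0:ℝ)..l, (2 : ℝ) := by
        apply intervalIntegral.integral_mono_on hl.le
        · apply Continuous.intervalIntegrable; fun_prop
        · simp
        · intro y hy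
          have h1 : y / l ≤ 1 := by rw [div_le_one hl]; exact hy.2
          have h0 : 0 ≤ y / l := div_nonneg hy.1 hl.le
          have := Real.cos_le_one (y * u)
          nlinarith [Real.neg_one_le_cos (y * u)]
    _ = 2 * l := by simp; ring

lemma fejK_ge {l : ℝ} (hl : 0 < l) {u : ℝ} (hu : |u| ≤ 1 / l) : l / 2 ≤ fejK l u := by
  unfold fejK
  calc l / 2 = ∫ y in (0:ℝ)..l, (1 - y / l) := by
        rw [intervalIntegral.integral_sub (by simp) (by apply Continuous.intervalIntegrable; fun_prop)]
        simp
        field_simp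
        ring
    _ ≤ _ := by
        apply intervalIntegral.integral_mono_on hl.le
        · apply Continuous.intervalIntegrable; fun_prop
        · apply Continuous.intervalIntegrable; fun_prop
        · intro y hy
          have h1 : y / l ≤ 1 := by rw [div_le_one hl]; exact hy.2
          have h2 : |y * u| ≤ 1 := by
            rw [abs_mul, abs_of_nonneg hy.1]
            calc y * |u| ≤ l * (1 / l) := by gcongr; exact hy.2
              _ = 1 := by field_simp
          have h3 : 1 / 2 ≤ Real.cos (y * u) := by
            have := Real.one_sub_sq_div_two_le_cos (x := y * u)
            have h4 : (y * u) ^ 2 ≤ 1 := by rw [← sq_abs]; nlinarith [abs_nonneg (y * u)]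
            linarith
          nlinarith

lemma fejK_integrable {l : ℝ} (hl : 0 < l) : Integrable (fejK l) := by
  have h0 : Integrable (fun u : ℝ => (4 / l + 2 * l) * (1 + u ^ 2)⁻¹) :=
    integrable_inv_one_add_sq.const_mul _
  have h0 : Integrable (fun u : ℝ => (2 * (4 / l + 2 * l)) * (1 + u ^ 2)⁻¹) :=
    integrable_inv_one_add_sq.const_mul _
  refine h0.mono' (fejK_continuous l).aestronglyMeasurable (ae_of_all _ fun u => ?_)
  rw [Real.norm_of_nonneg (fejK_nonneg hl u)]
  have h1 : 0 < 1 + u ^ 2 := by positivity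
  rw [← div_eq_mul_inv, le_div_iff₀ h1]
  rcases eq_or_ne u 0 with rfl | hu
  · have := fejK_le' hl 0
    have : 0 < 4 / l := by positivity
    nlinarith
  · have h2 := fejK_le' hl u
    have h3 := fejK_le hl hu
    have hu2 : 0 < u ^ 2 := by positivity
    have h4 : fejK l u * u ^ 2 ≤ 4 / l := by
      rw [← div_eq_mul_inv, le_div_iff₀ hu2] at h3; exact h3
    have : 0 < 4 / l := by positivity
    nlinarith

lemma fejK_integral_ge {l : ℝ} (hl : 0 < l) : 1 ≤ ∫ u, fejK l u := by
  have hi := fejK_integrable hl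
  have h1l : 0 < 1 / l := by positivity
  calc (1:ℝ) = ∫ u in Icc (-(1 / l)) (1 / l), (l / 2 : ℝ) := by
        simp [measureReal_def]
        rw [ENNReal.toReal_ofReal (by positivity)]
        field_simp; ring
    _ ≤ ∫ u in Icc (-(1 / l)) (1 / l), fejK l u := by
        apply setIntegral_mono_on
        · simp
        · exact hi.integrableOn
        · exact measurableSet_Icc
        · intro u hu
          exact fejK_ge hl (abs_le.mpr hu)
    _ ≤ _ := setIntegral_le_integral hi (ae_of_all _ (fejK_nonneg hl))

lemma fejK_tail {l η : ℝ} (hl : 0 < l) (hη : 0 < η) :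
    ∫ u in (Icc (-η) η)ᶜ, fejK l u ≤ 8 / (l * η) := by
  have hi := fejK_integrable hl
  have he : ∀ u, fejK l (-u) = fejK l u := by
    intro u; unfold fejK; simp
  have hc : (Icc (-η) η)ᶜ = Iio (-η) ∪ Ioi η := by
    ext u; simp only [mem_compl_iff, mem_Icc, mem_union, mem_Iio, mem_Ioi, not_and_or, not_le]
  have h1 : ∫ u in Ioi η, fejK l u ≤ 4 / (l * η) := by
    have hIntg : IntegrableOn (fun u : ℝ => u ^ (-2 : ℝ)) (Ioi η) :=
      integrableOn_Ioi_rpow_of_lt (by norm_num) hη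
    calc ∫ u in Ioi η, fejK l u ≤ ∫ u in Ioi η, 4 / l * u ^ (-2 : ℝ) := by
          apply setIntegral_mono_on hi.integrableOn (hIntg.const_mul _) measurableSet_Ioi
          intro u hu
          have hu0 : 0 < u := lt_trans hη hu
          have := fejK_le hl hu0.ne'
          rwa [Real.rpow_neg hu0.le, Real.rpow_two]
      _ = 4 / (l * η) := by
          rw [integral_const_mul, integral_Ioi_rpow_of_lt (by norm_num) hη]
          norm_num
          rw [Real.rpow_neg_one]
          field_simp
  have h2 : ∫ u in Iio (-η), fejK l u = ∫ u in Ioi η, fejK l u := by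
    rw [← integral_Iic_eq_integral_Iio, ← integral_comp_neg_Ioi]
    simp [he]
  rw [hc, setIntegral_union _ measurableSet_Ioi hi.integrableOn hi.integrableOn, h2]
  · calc _ ≤ 4 / (l * η) + 4 / (l * η) := by gcongr
      _ = _ := by ring
  · rw [Set.disjoint_left]
    intro u hu hu'
    simp at hu hu'
    linarith

end

section

open MeasureTheory Filter Topology Set

lemma wi_integrable {f : ℝ → ℝ} (hm : Measurable f) {M : ℝ} (hM : ∀ t, |f t| ≤ M)
    (hf0 : ∀ t ≤ 0, f t = 0) {δ : ℝ} (hδ : 0 < δ) :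
    Integrable (fun t => f t * Real.exp (-δ * t)) := by
  have h1 : IntegrableOn (fun t => M * Real.exp (-δ * t)) (Ioi 0) :=
    (exp_neg_integrableOn_Ioi 0 hδ).const_mul M
  have h2 : IntegrableOn (fun t => f t * Real.exp (-δ * t)) (Ioi 0) := by
    refine Integrable.mono' h1 ?_ (ae_of_all _ fun t => ?_)
    · exact (hm.mul (by fun_prop)).aestronglyMeasurable
    · rw [norm_mul, Real.norm_eq_abs, Real.norm_of_nonneg (Real.exp_pos _).le]
      gcongr
      exact hM t
  rw [← integrable_indicator_iff measurableSet_Ioi] at h2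
  refine h2.congr (ae_of_all _ fun t => ?_)
  by_cases ht : 0 < t
  · simp [indicator, ht]
  · simp [indicator, ht, hf0 t (not_lt.mp ht)]

lemma wi_fubini {f : ℝ → ℝ} (hm : Measurable f) {M : ℝ} (hM : ∀ t, |f t| ≤ M)
    (hf0 : ∀ t ≤ 0, f t = 0) {G : ℂ → ℂ}
    (hL : ∀ z : ℂ, 0 < z.re → ∫ t : ℝ, (f t : ℂ) * Complex.exp (-z * t) = G z)
    {l : ℝ} (hl : 0 < l) {δ : ℝ} (hδ : 0 < δ) (T : ℝ) :
    ((∫ t, f t * Real.exp (-δ * t) * fejK l (t - T) : ℝ) : ℂ) =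
     ∫ y in (0:ℝ)..l, (1 - y / l : ℂ) * (Complex.exp (y * T * Complex.I) * G (δ + y * Complex.I)
        + Complex.exp (-(y * T * Complex.I)) * G (δ - y * Complex.I)) := by
  have hi := wi_integrable hm hM hf0 hδ
  -- pointwise form
  have hpt : ∀ y : ℝ, (1 - y / l : ℂ) * (Complex.exp (y * T * Complex.I) * G (δ + y * Complex.I)
        + Complex.exp (-(y * T * Complex.I)) * G (δ - y * Complex.I)) =
      ((∫ t, (f t * Real.exp (-δ * t)) * ((1 - y / l) * (2 * Real.cos (y * (t - T)))) : ℝ) : ℂ) := by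
    intro y
    rw [← hL _ (by simp [hδ]), ← hL _ (by simp [hδ]), ← integral_const_mul, ← integral_const_mul,
      ← integral_add, ← integral_const_mul, ← integral_complex_ofReal]
    · congr 1
      ext t
      push_cast
      rw [Complex.two_cos]
      have e1 : Complex.exp (-(δ + y * Complex.I) * t) = Complex.exp (-δ * t) * Complex.exp (-(y * t * Complex.I)) := by
        rw [← Complex.exp_add]; ring_nf
      have e2 : Complex.exp (-(δ - y * Complex.I) * t) = Complex.exp (-δ * t) * Complex.exp ((y * t * Complex.I)) := by
        rw [← Complex.exp_add]; ring_nf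
      have e3 : Complex.exp (y * (t - T) * Complex.I) = Complex.exp (y * t * Complex.I) * Complex.exp (-(y * T * Complex.I)) := by
        rw [← Complex.exp_add]; ring_nf
      have e4 : Complex.exp (-(y * (t - T)) * Complex.I) = Complex.exp (-(y * t * Complex.I)) * Complex.exp ((y * T * Complex.I)) := by
        rw [← Complex.exp_add]; ring_nf
      rw [e1, e2, e3, e4]
      ring
    all_goals
      refine Integrable.const_mul ?_ _
      refine Integrable.mono hi ?_ (ae_of_all _ fun t => ?_)
      · exact ((Complex.measurable_ofReal.comp hm).mul (by fun_prop)).aestronglyMeasurable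
      · rw [norm_mul, norm_mul, Complex.norm_exp]
        simp
  simp_rw [hpt]
  rw [intervalIntegral.integral_ofReal]
  congr 1
  rw [intervalIntegral.integral_of_le hl.le, integral_integral_swap]
  · congr 1
    ext t
    rw [fejK, integral_const_mul, intervalIntegral.integral_of_le hl.le]
  · have h1 : Integrable (fun _ : ℝ => (1:ℝ)) (volume.restrict (Ioc 0 l)) := by simp
    have h2 := h1.mul_prod hi
    have h3 : AEStronglyMeasurable (fun z : ℝ × ℝ => (max 0 (min 1 (1 - z.1 / l))) * (2 * Real.cos (z.1 * (z.2 - T))))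
        ((volume.restrict (Ioc 0 l)).prod volume) := by
      apply Continuous.aestronglyMeasurable
      fun_prop
    have h4 := h2.bdd_mul (c := 2) h3 (ae_of_all _ fun z => by
      have h6 : 0 ≤ max 0 (min 1 (1 - z.1 / l)) := le_max_left _ _
      have h7 : max 0 (min 1 (1 - z.1 / l)) ≤ 1 := max_le zero_le_one (min_le_left _ _)
      rw [norm_mul, Real.norm_of_nonneg h6, norm_mul, Real.norm_two, Real.norm_eq_abs]
      have := Real.abs_cos_le_one (z.1 * (z.2 - T))
      nlinarith [abs_nonneg (Real.cos (z.1 * (z.2 - T)))])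
    refine h4.congr ?_
    have h8 : ∀ᵐ z ∂((volume.restrict (Ioc 0 l)).prod (volume : Measure ℝ)), z.1 ∈ Ioc 0 l := by
      apply Measure.quasiMeasurePreserving_fst.ae (p := fun y => y ∈ Ioc 0 l)
      exact ae_restrict_mem measurableSet_Ioc
    filter_upwards [h8] with z hz
    have h9 : z.1 / l ≤ 1 := by rw [div_le_one hl]; exact hz.2
    have h10 : 0 ≤ z.1 / l := div_nonneg hz.1.le hl.le
    simp only [Function.uncurry]
    rw [min_eq_right (by linarith), max_eq_right (by linarith)]
    ring

end

section

open MeasureTheory Filter Topology Set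

lemma wi_limit {f : ℝ → ℝ} (hm : Measurable f) {M : ℝ} (hM : ∀ t, |f t| ≤ M)
    (hf0 : ∀ t ≤ 0, f t = 0) {G : ℂ → ℂ} (hG : ContinuousOn G {z | 0 ≤ z.re})
    (hL : ∀ z : ℂ, 0 < z.re → ∫ t : ℝ, (f t : ℂ) * Complex.exp (-z * t) = G z)
    {l : ℝ} (hl : 0 < l) (T : ℝ) :
    ((∫ t, f t * fejK l (t - T) : ℝ) : ℂ) =
     ∫ y in (0:ℝ)..l, (1 - y / l : ℂ) * (Complex.exp (y * T * Complex.I) * G (y * Complex.I)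
        + Complex.exp (-(y * T * Complex.I)) * G (- (y * Complex.I))) := by
  set d : ℕ → ℝ := fun n => 1 / ((n : ℝ) + 1) with hd
  have hd0 : ∀ n, 0 < d n := fun n => by simp only [hd]; positivity
  have hd1 : ∀ n, d n ≤ 1 := fun n => by
    simp only [hd]; rw [div_le_one (by positivity)]; linarith [n.cast_nonneg (α := ℝ)]
  have hdt : Tendsto d atTop (𝓝 0) := tendsto_one_div_add_atTop_nhds_zero_nat
  have hM0 : 0 ≤ M := (abs_nonneg _).trans (hM 0)
  have hK : Integrable (fun t => fejK l (t - T)) := (fejK_integrable hl).comp_sub_right T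
  -- left limit
  have h1 : Tendsto (fun n => ((∫ t, f t * Real.exp (-(d n) * t) * fejK l (t - T) : ℝ) : ℂ)) atTop
      (𝓝 ((∫ t, f t * fejK l (t - T) : ℝ) : ℂ)) := by
    refine (Complex.continuous_ofReal.tendsto _).comp ?_
    apply tendsto_integral_of_dominated_convergence (fun t => M * fejK l (t - T))
    · intro n
      exact ((hm.mul (by fun_prop)).mul ((fejK_continuous l).measurable.comp (by fun_prop))).aestronglyMeasurable
    · exact hK.const_mul M
    · intro n
      refine ae_of_all _ fun t => ?_
      rw [norm_mul, norm_mul, Real.norm_of_nonneg (fejK_nonneg hl _), Real.norm_of_nonneg (Real.exp_pos _).le,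
        Real.norm_eq_abs]
      refine mul_le_mul_of_nonneg_right ?_ (fejK_nonneg hl _)
      rcases le_or_gt t 0 with ht | ht
      · rw [hf0 t ht]; simpa using hM0
      · have : Real.exp (-(d n) * t) ≤ 1 := by
          rw [Real.exp_le_one_iff]; nlinarith [hd0 n]
        nlinarith [hM t, abs_nonneg (f t), Real.exp_pos (-(d n) * t)]
    · refine ae_of_all _ fun t => ?_
      have : Tendsto (fun n => f t * Real.exp (-(d n) * t) * fejK l (t - T)) atTop
          (𝓝 (f t * Real.exp (-0 * t) * fejK l (t - T))) := by
        refine Tendsto.mul_const _ (Tendsto.const_mul _ ?_)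
        exact (Real.continuous_exp.tendsto _).comp ((hdt.neg).mul_const t)
      simpa using this
  -- right limit
  have hcomp : IsCompact ((fun p : ℝ × ℝ => ((p.1 : ℂ) + p.2 * Complex.I)) '' (Icc 0 1 ×ˢ Icc (-l) l)) := by
    apply (isCompact_Icc.prod isCompact_Icc).image
    fun_prop
  obtain ⟨C, hC⟩ := hcomp.exists_bound_of_continuousOn (hG.mono (by
    rintro _ ⟨⟨a, b⟩, ⟨h1, h2⟩, rfl⟩
    simpa using h1.1))
  have hC1 : ∀ a ∈ Icc (0:ℝ) 1, ∀ b ∈ Icc (-l) l, ‖G (a + b * Complex.I)‖ ≤ C := by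
    intro a ha b hb
    exact hC _ ⟨(a, b), ⟨ha, hb⟩, rfl⟩
  have hC0 : 0 ≤ C := (norm_nonneg _).trans (hC1 0 (by simp) 0 (by constructor <;> linarith))
  have hplus : Continuous (fun p : ℝ × ℝ => G ((|p.1| : ℝ) + p.2 * Complex.I)) := by
    apply hG.comp_continuous (by fun_prop)
    intro p; simp
  have h2 : Tendsto (fun n => ∫ y in (0:ℝ)..l, (1 - y / l : ℂ) * (Complex.exp (y * T * Complex.I) * G (d n + y * Complex.I)
        + Complex.exp (-(y * T * Complex.I)) * G (d n - y * Complex.I))) atTop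
      (𝓝 (∫ y in (0:ℝ)..l, (1 - y / l : ℂ) * (Complex.exp (y * T * Complex.I) * G (y * Complex.I)
        + Complex.exp (-(y * T * Complex.I)) * G (- (y * Complex.I))))) := by
    apply intervalIntegral.tendsto_integral_filter_of_dominated_convergence (fun _ => 2 * C)
    · refine Eventually.of_forall fun n => Continuous.aestronglyMeasurable ?_
      have c1 : Continuous (fun y : ℝ => G (d n + y * Complex.I)) := by
        have := hplus.comp (show Continuous (fun y : ℝ => (d n, y)) by fun_prop)
        simpa [Function.comp_def, abs_of_pos (hd0 n)] using this
      have c2 : Continuous (fun y : ℝ => G (d n - y * Complex.I)) := by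
        have := hplus.comp (show Continuous (fun y : ℝ => (d n, -y)) by fun_prop)
        simpa [Function.comp_def, abs_of_pos (hd0 n), sub_eq_add_neg] using this
      exact (continuous_const.sub (Complex.continuous_ofReal.div_const _)).mul
        (((by fun_prop : Continuous fun y : ℝ => Complex.exp (y * T * Complex.I)).mul c1).add
        ((by fun_prop : Continuous fun y : ℝ => Complex.exp (-(y * T * Complex.I))).mul c2))
    · refine Eventually.of_forall fun n => ae_of_all _ fun y hy => ?_
      rw [uIoc_of_le hl.le] at hy
      have a1 : ‖(1 - y / l : ℂ)‖ ≤ 1 := by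
        have : (1 - y / l : ℂ) = ((1 - y / l : ℝ) : ℂ) := by push_cast; rfl
        rw [this, Complex.norm_real, Real.norm_eq_abs, abs_le]
        have h9 : y / l ≤ 1 := by rw [div_le_one hl]; exact hy.2
        have h10 : 0 ≤ y / l := div_nonneg hy.1.le hl.le
        constructor <;> linarith
      have a2 := hC1 (d n) ⟨(hd0 n).le, hd1 n⟩ y ⟨by linarith [hy.1], hy.2⟩
      have a3 := hC1 (d n) ⟨(hd0 n).le, hd1 n⟩ (-y) ⟨by linarith [hy.2], by linarith [hy.1]⟩
      have e1 : ‖Complex.exp (y * T * Complex.I)‖ = 1 := by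
        rw [Complex.norm_exp]; simp
      have e2 : ‖Complex.exp (-(y * T * Complex.I))‖ = 1 := by
        rw [Complex.norm_exp]; simp
      rw [norm_mul]
      calc _ ≤ 1 * (C + C) := by
            refine mul_le_mul a1 ((norm_add_le _ _).trans ?_) (norm_nonneg _) zero_le_one
            rw [norm_mul, norm_mul, e1, e2, one_mul, one_mul]
            refine add_le_add a2 ?_
            convert! a3 using 3
            push_cast; ring
        _ = 2 * C := by ring
    · simp
    · refine ae_of_all _ fun y hy => ?_
      refine Tendsto.const_mul _ (Tendsto.add (Tendsto.const_mul _ ?_) (Tendsto.const_mul _ ?_))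
      · have := (hplus.tendsto (0, y)).comp (hdt.prodMk_nhds (tendsto_const_nhds (x := y)))
        simpa [Function.comp_def, abs_of_pos (hd0 _)] using this
      · have := (hplus.tendsto (0, -y)).comp (hdt.prodMk_nhds (tendsto_const_nhds (x := -y)))
        simpa [Function.comp_def, abs_of_pos (hd0 _), sub_eq_add_neg] using this
  refine tendsto_nhds_unique h1 (h2.congr fun n => ?_)
  rw [wi_fubini hm hM hf0 hL hl (hd0 n) T]

lemma rl_interval (g : ℝ → ℂ) (l : ℝ) (hl : 0 < l) :
    Tendsto (fun T : ℝ => ∫ y in (0:ℝ)..l, Complex.exp (y * T * Complex.I) * g y) (cocompact ℝ) (𝓝 0) := by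
  have h := Real.tendsto_integral_exp_smul_cocompact ((Ioc 0 l).indicator g)
  have h2 : Tendsto (fun T : ℝ => T * (-(2 * Real.pi)⁻¹)) (cocompact ℝ) (cocompact ℝ) := by
    have : (-(2 * Real.pi)⁻¹) ≠ 0 := by
      simp [Real.pi_ne_zero]
    exact (Homeomorph.mulRight₀ _ this).isClosedEmbedding.tendsto_cocompact
  refine (h.comp h2).congr fun T => ?_
  rw [intervalIntegral.integral_of_le hl.le, ← integral_indicator measurableSet_Ioc]
  simp only [Function.comp]
  congr 1
  ext y
  by_cases hy : y ∈ Ioc 0 l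
  · simp only [indicator_of_mem hy]
    rw [Circle.smul_def, Real.fourierChar_apply, smul_eq_mul]
    congr 2
    push_cast
    have := Complex.ofReal_ne_zero.mpr Real.pi_ne_zero
    field_simp
  · simp [indicator_of_notMem hy]

lemma wi_kernel {f : ℝ → ℝ} (hm : Measurable f) {M : ℝ} (hM : ∀ t, |f t| ≤ M)
    (hf0 : ∀ t ≤ 0, f t = 0) {G : ℂ → ℂ} (hG : ContinuousOn G {z | 0 ≤ z.re})
    (hL : ∀ z : ℂ, 0 < z.re → ∫ t : ℝ, (f t : ℂ) * Complex.exp (-z * t) = G z)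
    {l : ℝ} (hl : 0 < l) :
    Tendsto (fun T => ∫ t, f t * fejK l (t - T)) atTop (𝓝 0) := by
  have hplus : Continuous (fun y : ℝ => G (y * Complex.I)) := by
    apply hG.comp_continuous (by fun_prop)
    intro p; simp
  have hminus : Continuous (fun y : ℝ => G (-(y * Complex.I))) := by
    apply hG.comp_continuous (by fun_prop)
    intro p; simp
  have r1 := (rl_interval (fun y => (1 - y / l : ℂ) * G (y * Complex.I)) l hl).mono_left
    atTop_le_cocompact
  have r2 := ((rl_interval (fun y => (1 - y / l : ℂ) * G (-(y * Complex.I))) l hl).mono_left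
    atBot_le_cocompact).comp tendsto_neg_atTop_atBot
  have r3 : Tendsto (fun T => ((∫ t, f t * fejK l (t - T) : ℝ) : ℂ)) atTop (𝓝 0) := by
    have := r1.add r2
    rw [add_zero] at this
    refine this.congr fun T => ?_
    rw [wi_limit hm hM hf0 hG hL hl T]
    simp only [Function.comp]
    rw [← intervalIntegral.integral_add]
    · congr 1
      ext y
      have : (y : ℂ) * ((-T : ℝ) : ℂ) * Complex.I = -(y * T * Complex.I) := by push_cast; ring
      rw [this]
      ring
    · apply Continuous.intervalIntegrable
      exact (by fun_prop : Continuous fun y : ℝ => Complex.exp (y * T * Complex.I)).mul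
        ((continuous_const.sub (Complex.continuous_ofReal.div_const _)).mul hplus)
    · apply Continuous.intervalIntegrable
      exact (by fun_prop : Continuous fun y : ℝ => Complex.exp (y * (-T : ℝ) * Complex.I)).mul
        ((continuous_const.sub (Complex.continuous_ofReal.div_const _)).mul hminus)
  have r4 := (Complex.continuous_re.tendsto _).comp r3
  simpa [Function.comp_def] using r4

end

section

open MeasureTheory Filter Topology Set

lemma wi_kernelB {B : ℝ → ℝ} (hm : Measurable B) {M : ℝ} (hB0 : ∀ t, 0 ≤ B t) (hBM : ∀ t, B t ≤ M)
    (hBz : ∀ t ≤ 0, B t = 0) {A : ℝ} (hA : 0 ≤ A)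
    {G : ℂ → ℂ} (hG : ContinuousOn G {z | 0 ≤ z.re})
    (hL : ∀ z : ℂ, 0 < z.re → ∫ t : ℝ, (B t : ℂ) * Complex.exp (-z * t) = G z + A / z)
    {l : ℝ} (hl : 0 < l) :
    Tendsto (fun T => ∫ t, B t * fejK l (t - T)) atTop (𝓝 (A * ∫ u, fejK l u)) := by
  have hM0 : 0 ≤ M := (hB0 0).trans (hBM 0)
  set f : ℝ → ℝ := fun t => B t - (Ioi 0).indicator (fun _ => A) t with hf
  have hind : Measurable ((Ioi (0:ℝ)).indicator (fun _ => A)) := measurable_const.indicator measurableSet_Ioi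
  have hfm : Measurable f := hm.sub hind
  have hi0 : ∀ t, 0 ≤ (Ioi (0:ℝ)).indicator (fun _ => A) t := fun t => indicator_nonneg (fun _ _ => hA) t
  have hi1 : ∀ t, (Ioi (0:ℝ)).indicator (fun _ => A) t ≤ A := fun t => indicator_le_self' (fun _ _ => hA) t
  have hfM : ∀ t, |f t| ≤ M + A := by
    intro t
    rw [abs_le]
    constructor <;> simp only [hf] <;> linarith [hB0 t, hBM t, hi0 t, hi1 t]
  have hf0 : ∀ t ≤ 0, f t = 0 := by
    intro t ht
    simp [hf, hBz t ht, indicator, ht]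
  have hfL : ∀ z : ℂ, 0 < z.re → ∫ t : ℝ, (f t : ℂ) * Complex.exp (-z * t) = G z := by
    intro z hz
    have e0 : ∀ t : ℝ, (((Ioi (0:ℝ)).indicator (fun _ => A) t : ℝ) : ℂ) * Complex.exp (-z * t) =
        (Ioi (0:ℝ)).indicator (fun t : ℝ => (A : ℂ) * Complex.exp (-z * t)) t := by
      intro t
      by_cases ht : 0 < t <;> simp [indicator, ht]
    have e1 : ∫ t : ℝ, (((Ioi (0:ℝ)).indicator (fun _ => A) t : ℝ) : ℂ) * Complex.exp (-z * t) = A / z := by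
      simp_rw [e0]
      rw [integral_indicator measurableSet_Ioi, integral_const_mul,
        integral_exp_mul_complex_Ioi (by simpa using hz)]
      have : z ≠ 0 := by rintro rfl; simp at hz
      simp
      field_simp
    have hgen : ∀ g : ℝ → ℝ, Measurable g → (∀ t, |g t| ≤ M + A) → (∀ t ≤ 0, g t = 0) →
        Integrable (fun t : ℝ => (g t : ℂ) * Complex.exp (-z * t)) := by
      intro g hg h1 h2
      refine Integrable.mono (wi_integrable hg h1 h2 hz) ?_ (ae_of_all _ fun t => ?_)
      · exact ((Complex.measurable_ofReal.comp hg).mul (by fun_prop)).aestronglyMeasurable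
      · rw [norm_mul, norm_mul, Complex.norm_exp]
        simp
    calc ∫ t : ℝ, (f t : ℂ) * Complex.exp (-z * t)
        = ∫ t : ℝ, ((B t : ℂ) * Complex.exp (-z * t) -
          (((Ioi (0:ℝ)).indicator (fun _ => A) t : ℝ) : ℂ) * Complex.exp (-z * t)) := by
          congr 1; ext t; simp only [hf]; push_cast; ring
      _ = G z := by
          rw [integral_sub, hL z hz, e1]
          · ring
          · apply hgen B hm _ hBz
            intro t; rw [abs_of_nonneg (hB0 t)]; linarith [hBM t]
          · apply hgen _ hind
            · intro t; rw [abs_of_nonneg (hi0 t)]; linarith [hi1 t]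
            · intro t ht; simp [indicator, ht]
  have h1 := wi_kernel hfm hfM hf0 hG hfL hl
  have hK := fejK_integrable hl
  have h2 : Tendsto (fun T : ℝ => ∫ t, (Ioi (0:ℝ)).indicator (fun _ => A) t * fejK l (t - T)) atTop
      (𝓝 (A * ∫ u, fejK l u)) := by
    have h3 : ∀ T : ℝ, ∫ t, (Ioi (0:ℝ)).indicator (fun _ => A) t * fejK l (t - T)
        = ∫ u, (Ioi (0:ℝ)).indicator (fun _ => A) (u + T) * fejK l u := by
      intro T
      rw [← integral_add_right_eq_self _ T]
      simp
    simp_rw [h3]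
    rw [← integral_const_mul]
    apply tendsto_integral_filter_of_dominated_convergence (fun u => A * fejK l u)
    · refine Eventually.of_forall fun T => ?_
      exact ((hind.comp (by fun_prop)).mul (fejK_continuous l).measurable).aestronglyMeasurable
    · refine Eventually.of_forall fun T => ae_of_all _ fun u => ?_
      rw [norm_mul, Real.norm_of_nonneg (hi0 _), Real.norm_of_nonneg (fejK_nonneg hl u)]
      exact mul_le_mul_of_nonneg_right (hi1 _) (fejK_nonneg hl u)
    · exact hK.const_mul A
    · refine ae_of_all _ fun u => ?_
      refine tendsto_const_nhds.congr' ?_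
      filter_upwards [eventually_gt_atTop (-u)] with T hT
      rw [indicator_of_mem (by simp; linarith)]
  have h4 := h1.add h2
  rw [zero_add] at h4
  refine h4.congr fun T => ?_
  have hKT : Integrable (fun t => fejK l (t - T)) := hK.comp_sub_right T
  rw [← integral_add]
  · congr 1; ext t; simp only [hf]; ring
  · exact hKT.bdd_mul (c := M + A) hfm.aestronglyMeasurable (ae_of_all _ hfM)
  · refine hKT.bdd_mul (c := A) hind.aestronglyMeasurable (ae_of_all _ fun t => ?_)
    rw [Real.norm_of_nonneg (hi0 _)]; exact hi1 t

lemma wi_tauber {B : ℝ → ℝ} (hm : Measurable B) {M : ℝ} (hB0 : ∀ t, 0 ≤ B t) (hBM : ∀ t, B t ≤ M)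
    (hBz : ∀ t ≤ 0, B t = 0) (hmono : ∀ s t, s ≤ t → B s * Real.exp s ≤ B t * Real.exp t)
    {A : ℝ} (hA : 0 ≤ A)
    {G : ℂ → ℂ} (hG : ContinuousOn G {z | 0 ≤ z.re})
    (hL : ∀ z : ℂ, 0 < z.re → ∫ t : ℝ, (B t : ℂ) * Complex.exp (-z * t) = G z + A / z) :
    Tendsto B atTop (𝓝 A) := by
  have hM0 : 0 ≤ M := (hB0 0).trans (hBM 0)
  -- comparison
  have hcmp : ∀ s t h, s ≤ t → t ≤ s + h → B s * Real.exp (-h) ≤ B t := by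
    intro s t h h1 h2
    have := hmono s t h1
    have e : B s * Real.exp (s - t) ≤ B t := by
      rw [Real.exp_sub, mul_div_assoc', div_le_iff₀ (Real.exp_pos t)]; exact this
    refine le_trans ?_ e
    exact mul_le_mul_of_nonneg_left (Real.exp_le_exp.mpr (by linarith)) (hB0 s)
  -- two-sided eventual bound for each η
  have key : ∀ η : ℝ, 0 < η → η < 1 → ∀ᶠ T in atTop,
      B T * Real.exp (-(2 * η)) * (1 - η) ≤ A + η ∧
      A - (1 + M) * η ≤ B T * Real.exp (2 * η) := by
    intro η hη hη1
    set l : ℝ := 8 / η ^ 2 with hl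
    have hlpos : 0 < l := by positivity
    have htail : ∫ u in (Icc (-η) η)ᶜ, fejK l u ≤ η := by
      refine (fejK_tail hlpos hη).trans (le_of_eq ?_)
      rw [hl]; field_simp
    have hK := fejK_integrable hlpos
    set c := ∫ u, fejK l u with hc
    have hc1 : 1 ≤ c := fejK_integral_ge hlpos
    have hsplit : (∫ u in Icc (-η) η, fejK l u) + ∫ u in (Icc (-η) η)ᶜ, fejK l u = c :=
      integral_add_compl measurableSet_Icc hK
    have hconv := wi_kernelB hm hB0 hBM hBz hA hG hL hlpos
    have hBK : ∀ T, Integrable (fun u => B (u + T) * fejK l u) := by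
      intro T
      refine hK.bdd_mul (c := M) (hm.comp (by fun_prop)).aestronglyMeasurable (ae_of_all _ fun t => ?_)
      rw [Real.norm_of_nonneg (hB0 _)]; exact hBM _
    have hshift : ∀ T, ∫ t, B t * fejK l (t - T) = ∫ u, B (u + T) * fejK l u := by
      intro T
      rw [← integral_add_right_eq_self _ T]
      simp
    simp_rw [hshift] at hconv
    rw [Metric.tendsto_atTop] at hconv
    obtain ⟨N, hN⟩ := hconv η hη
    filter_upwards [eventually_ge_atTop (N + η)] with T hT
    constructor
    · have h1 := hN (T + η) (by linarith)
      rw [Real.dist_eq, abs_lt] at h1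
      have h2 : B T * Real.exp (-(2 * η)) * ∫ u in Icc (-η) η, fejK l u ≤
          ∫ u, B (u + (T + η)) * fejK l u := by
        rw [← integral_const_mul]
        refine le_trans ?_ (setIntegral_le_integral (s := Icc (-η) η) (hBK (T + η))
          (ae_of_all _ fun u => mul_nonneg (hB0 _) (fejK_nonneg hlpos u)))
        apply setIntegral_mono_on (hK.integrableOn.const_mul _) (hBK _).integrableOn measurableSet_Icc
        intro u hu
        refine mul_le_mul_of_nonneg_right ?_ (fejK_nonneg hlpos u)
        apply hcmp <;> linarith [hu.1, hu.2]
      have h3 : 0 ≤ B T * Real.exp (-(2 * η)) := mul_nonneg (hB0 _) (Real.exp_pos _).le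
      have h4 : B T * Real.exp (-(2 * η)) * (c * (1 - η)) ≤ c * (A + η) := by
        calc _ ≤ B T * Real.exp (-(2 * η)) * ∫ u in Icc (-η) η, fejK l u := by
              apply mul_le_mul_of_nonneg_left _ h3
              nlinarith
          _ ≤ A * c + η := by linarith
          _ ≤ c * (A + η) := by nlinarith
      have h5 : c * (B T * Real.exp (-(2 * η)) * (1 - η)) ≤ c * (A + η) := by linarith
      exact le_of_mul_le_mul_left h5 (by linarith)
    · have h1 := hN (T - η) (by linarith)
      rw [Real.dist_eq, abs_lt] at h1
      have h2 : ∫ u, B (u + (T - η)) * fejK l u ≤ B T * Real.exp (2 * η) * c + M * η := by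
        rw [← integral_add_compl (measurableSet_Icc (a := -η) (b := η)) (hBK _)]
        apply add_le_add
        · calc _ ≤ ∫ u in Icc (-η) η, B T * Real.exp (2 * η) * fejK l u := by
                apply setIntegral_mono_on (hBK _).integrableOn (hK.integrableOn.const_mul _) measurableSet_Icc
                intro u hu
                refine mul_le_mul_of_nonneg_right ?_ (fejK_nonneg hlpos u)
                have := hcmp (u + (T - η)) T (2 * η) (by linarith [hu.2]) (by linarith [hu.1])
                rw [Real.exp_neg, ← div_eq_mul_inv, div_le_iff₀ (Real.exp_pos _)] at this
                exact this
            _ = B T * Real.exp (2 * η) * ∫ u in Icc (-η) η, fejK l u := integral_const_mul _ _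
            _ ≤ _ := by
                apply mul_le_mul_of_nonneg_left _ (mul_nonneg (hB0 _) (Real.exp_pos _).le)
                exact setIntegral_le_integral hK (ae_of_all _ (fejK_nonneg hlpos))
        · calc _ ≤ ∫ u in (Icc (-η) η)ᶜ, M * fejK l u := by
                apply setIntegral_mono_on (hBK _).integrableOn (hK.integrableOn.const_mul _) measurableSet_Icc.compl
                intro u hu
                exact mul_le_mul_of_nonneg_right (hBM _) (fejK_nonneg hlpos u)
            _ = M * ∫ u in (Icc (-η) η)ᶜ, fejK l u := integral_const_mul _ _
            _ ≤ _ := mul_le_mul_of_nonneg_left htail hM0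
      have h3 : c * (A - (1 + M) * η) ≤ c * (B T * Real.exp (2 * η)) := by
        have : (1 + M) * η ≤ c * ((1 + M) * η) := by
          have : 0 ≤ (1 + M) * η := by positivity
          nlinarith
        nlinarith
      exact le_of_mul_le_mul_left h3 (by linarith)
  -- conclude
  rw [tendsto_order]
  constructor
  · intro a ha
    have hlim : Tendsto (fun η : ℝ => (A - (1 + M) * η) * Real.exp (-(2 * η))) (𝓝[>] 0) (𝓝 A) := by
      have : Continuous (fun η : ℝ => (A - (1 + M) * η) * Real.exp (-(2 * η))) := by fun_prop
      have h := this.tendsto 0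
      simp at h
      exact h.mono_left nhdsWithin_le_nhds
    obtain ⟨η, h1, h2, h3⟩ := ((hlim.eventually (lt_mem_nhds ha)).and
      ((Ioo_mem_nhdsGT (show (0:ℝ) < 1 by norm_num)))).exists
    filter_upwards [key η h2 h3] with T hT
    refine lt_of_lt_of_le h1 ?_
    rw [Real.exp_neg, ← div_eq_mul_inv, div_le_iff₀ (Real.exp_pos _)]
    exact hT.2
  · intro a ha
    have hlim : Tendsto (fun η : ℝ => (A + η) / (Real.exp (-(2 * η)) * (1 - η))) (𝓝[>] 0) (𝓝 A) := by
      have : ContinuousAt (fun η : ℝ => (A + η) / (Real.exp (-(2 * η)) * (1 - η))) 0 := by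
        apply ContinuousAt.div <;> [fun_prop; fun_prop; simp]
      have h := this.tendsto
      simp at h
      exact h.mono_left nhdsWithin_le_nhds
    obtain ⟨η, h1, h2, h3⟩ := ((hlim.eventually (gt_mem_nhds ha)).and
      ((Ioo_mem_nhdsGT (show (0:ℝ) < 1 by norm_num)))).exists
    filter_upwards [key η h2 h3] with T hT
    refine lt_of_le_of_lt ?_ h1
    rw [le_div_iff₀ (mul_pos (Real.exp_pos _) (by linarith)), ← mul_assoc]
    exact hT.1

end

section

open MeasureTheory Filter Topology Set

/-- Chebyshev function of the residue class `1` mod `q`. -/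
noncomputable def psiAP (q : ℕ) (x : ℝ) : ℝ :=
  ∑ n ∈ Finset.Icc 1 ⌊x⌋₊, ArithmeticFunction.vonMangoldt.residueClass (1 : ZMod q) n

lemma psiAP_nonneg (q : ℕ) (x : ℝ) : 0 ≤ psiAP q x :=
  Finset.sum_nonneg fun _ _ => ArithmeticFunction.vonMangoldt.residueClass_nonneg _ _

lemma psiAP_mono (q : ℕ) : Monotone (psiAP q) := by
  intro x y hxy
  apply Finset.sum_le_sum_of_subset_of_nonneg
  · exact Finset.Icc_subset_Icc_right (Nat.floor_mono hxy)
  · intro n _ _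
    exact ArithmeticFunction.vonMangoldt.residueClass_nonneg _ _

lemma psiAP_le (q : ℕ) {x : ℝ} (hx : 0 ≤ x) : psiAP q x ≤ (Real.log 4 + 4) * x := by
  refine le_trans ?_ (Chebyshev.psi_le_const_mul_self hx)
  unfold psiAP Chebyshev.psi
  exact Finset.sum_le_sum fun n _ => ArithmeticFunction.vonMangoldt.residueClass_le _ _

lemma psiAP_zero (q : ℕ) {x : ℝ} (hx : x ≤ 1) : psiAP q x = 0 := by
  rcases lt_or_eq_of_le hx with h | rfl
  · unfold psiAP
    rw [Nat.floor_eq_zero.mpr h]; simp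
  · simp [psiAP, indicator]

lemma psiAP_laplace (q : ℕ) {z : ℂ} (hz : 0 < z.re) :
    ∫ t : ℝ, ((psiAP q (Real.exp t) * Real.exp (-t) : ℝ) : ℂ) * Complex.exp (-z * t) =
      LSeries (fun n => ((ArithmeticFunction.vonMangoldt.residueClass (1 : ZMod q) n : ℝ) : ℂ)) (1 + z) / (1 + z) := by
  have hs : (1:ℝ) < (1 + z).re := by simpa using hz
  have hs0 : (1 + z) ≠ 0 := by
    intro h; rw [h] at hs; simp at hs; linarith
  rw [LSeries_eq_mul_integral_of_nonneg _ zero_le_one hs ?_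
    (ArithmeticFunction.vonMangoldt.residueClass_nonneg _), mul_div_cancel_left₀ _ hs0]
  · have himg : Real.exp '' (Ioi 0) = Ioi 1 := by
      ext y
      constructor
      · rintro ⟨x, hx, rfl⟩
        exact Real.one_lt_exp_iff.mpr hx
      · intro hy
        exact ⟨Real.log y, Real.log_pos hy, Real.exp_log (lt_trans one_pos hy)⟩
    rw [← himg, integral_image_eq_integral_abs_deriv_smul measurableSet_Ioi
      (fun x _ => (Real.hasDerivAt_exp x).hasDerivWithinAt) Real.exp_injective.injOn,
      ← integral_indicator measurableSet_Ioi]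
    congr 1
    ext t
    by_cases ht : 0 < t
    · rw [indicator_of_mem (show t ∈ Ioi 0 from ht)]
      rw [abs_of_pos (Real.exp_pos t), Complex.real_smul, psiAP]
      push_cast
      rw [show (Complex.exp t) ^ (-(1 + z + 1)) = Complex.exp (t * (-(1 + z + 1))) by
        rw [Complex.cpow_def_of_ne_zero (Complex.exp_ne_zero _), ← Complex.ofReal_exp, ← Complex.ofReal_log (Real.exp_pos _).le, Real.log_exp]]
      rw [mul_assoc, ← Complex.exp_add, mul_left_comm, ← Complex.exp_add]
      ring_nf
    · rw [indicator_of_notMem (show t ∉ Ioi 0 from ht), psiAP_zero]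
      · simp
      · simpa using ht
  · apply Asymptotics.IsBigO.of_bound (Real.log 4 + 4)
    refine Eventually.of_forall fun n => ?_
    have h1 := psiAP_nonneg q n
    have h2 := psiAP_le q (x := n) (by positivity)
    simp only [psiAP, Nat.floor_natCast] at h1 h2
    rw [Real.norm_of_nonneg h1, Real.rpow_one, Real.norm_of_nonneg (by positivity)]
    exact h2

theorem psiAP_tendsto_exp (q : ℕ) [NeZero q] :
    Tendsto (fun t => psiAP q (Real.exp t) * Real.exp (-t)) atTop (𝓝 ((q.totient : ℝ)⁻¹)) := by
  have hcont := ArithmeticFunction.vonMangoldt.continuousOn_LFunctionResidueClassAux (1 : ZMod q)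
  have heq := ArithmeticFunction.vonMangoldt.eqOn_LFunctionResidueClassAux (q := q) (a := 1) isUnit_one
  set H := ArithmeticFunction.vonMangoldt.LFunctionResidueClassAux (1 : ZMod q) with hH
  have hmeas : Measurable (fun t => psiAP q (Real.exp t) * Real.exp (-t)) :=
    ((psiAP_mono q).measurable.comp Real.measurable_exp).mul (by fun_prop)
  refine wi_tauber (G := fun z => (H (1 + z) - (q.totient : ℂ)⁻¹) / (1 + z)) hmeas (M := Real.log 4 + 4) ?_ ?_ ?_ ?_ (by positivity) ?_ ?_
  · intro t; exact mul_nonneg (psiAP_nonneg _ _) (Real.exp_pos _).le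
  · intro t
    have := psiAP_le q (Real.exp_pos t).le
    rw [Real.exp_neg, ← div_eq_mul_inv, div_le_iff₀ (Real.exp_pos _)]
    exact this
  · intro t ht
    rw [psiAP_zero]
    · simp
    · simpa using ht
  · intro s t hst
    have e : ∀ s, psiAP q (Real.exp s) * Real.exp (-s) * Real.exp s = psiAP q (Real.exp s) := by
      intro s; rw [mul_assoc, ← Real.exp_add]; simp
    rw [e, e]
    exact psiAP_mono q (Real.exp_le_exp.mpr hst)
  · apply ContinuousOn.div
    · apply ContinuousOn.sub _ continuousOn_const
      apply hcont.comp (by fun_prop)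
      intro z hz
      simpa using hz
    · fun_prop
    · intro z hz h
      have := congrArg Complex.re h
      simp at this hz
      linarith
  · intro z hz
    rw [psiAP_laplace q hz]
    have h1 := heq (x := 1 + z) (by simpa using hz)
    simp only [add_sub_cancel_left] at h1
    have hz0 : z ≠ 0 := by rintro rfl; simp at hz
    have hz1 : 1 + z ≠ 0 := by
      intro h
      have := congrArg Complex.re h
      simp at this
      linarith
    rw [h1]
    push_cast
    field_simp
    ring

theorem psiAP_tendsto (q : ℕ) [NeZero q] :
    Tendsto (fun x : ℝ => psiAP q x / x) atTop (𝓝 ((q.totient : ℝ)⁻¹)) := by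
  refine ((psiAP_tendsto_exp q).comp Real.tendsto_log_atTop).congr' ?_
  filter_upwards [eventually_gt_atTop 0] with x hx
  simp only [Function.comp]
  rw [Real.exp_neg, Real.exp_log hx, div_eq_mul_inv]

end

section

open Filter Topology

/-- Number of primes `p ≤ N` with `d ∣ p - 1`. -/
def cntAP (d N : ℕ) : ℕ := ((Finset.filter Nat.Prime (Finset.Iic N)).filter (fun p => d ∣ p - 1)).card

noncomputable def thetaAP (d N : ℕ) : ℝ :=
  ∑ p ∈ (Finset.filter Nat.Prime (Finset.Iic N)).filter (fun p => d ∣ p - 1), Real.log p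

lemma cast_eq_one_iff {d p : ℕ} (hp : 1 ≤ p) : ((p : ZMod d) = 1) ↔ d ∣ p - 1 := by
  rw [← Nat.cast_one, eq_comm, ZMod.natCast_eq_natCast_iff, Nat.modEq_iff_dvd' hp]

lemma primesIic_eq (N : ℕ) : Finset.filter Nat.Prime (Finset.Iic N) = Finset.filter Nat.Prime (Finset.Ioc 0 N) := by
  ext p
  simp only [Finset.mem_filter, Finset.mem_Iic, Finset.mem_Ioc]
  exact ⟨fun h => ⟨⟨h.2.pos, h.1⟩, h.2⟩, fun h => ⟨h.1.2, h.2⟩⟩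

lemma primesIic_card (N : ℕ) : (Finset.filter Nat.Prime (Finset.Iic N)).card = Nat.primeCounting N := by
  rw [Nat.primeCounting, Nat.primeCounting', Nat.count_eq_card_filter_range]
  congr 1
  ext p
  simp

lemma psiAP_sub_thetaAP (d N : ℕ) :
    psiAP d N - thetaAP d N = ∑ n ∈ (Finset.Ioc 0 N).filter (fun n => ¬ n.Prime),
      ArithmeticFunction.vonMangoldt.residueClass (1 : ZMod d) n := by
  have h1 : thetaAP d N = ∑ n ∈ (Finset.Ioc 0 N).filter (fun n => n.Prime),
      ArithmeticFunction.vonMangoldt.residueClass (1 : ZMod d) n := by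
    unfold thetaAP
    rw [primesIic_eq, Finset.sum_filter]
    apply Finset.sum_congr rfl
    intro p hp
    simp only [Finset.mem_filter] at hp
    have := cast_eq_one_iff (d := d) hp.2.one_le
    by_cases h : d ∣ p - 1
    · have h' : p ∈ {n : ℕ | (n : ZMod d) = 1} := this.mpr h
      rw [if_pos h, ArithmeticFunction.vonMangoldt.residueClass, Set.indicator_of_mem h',
        ArithmeticFunction.vonMangoldt_apply_prime hp.2]
    · have h' : p ∉ {n : ℕ | (n : ZMod d) = 1} := fun h' => h (this.mp h')
      rw [if_neg h, ArithmeticFunction.vonMangoldt.residueClass, Set.indicator_of_notMem h']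
  rw [h1, psiAP, Nat.floor_natCast]
  have h2 : Finset.Icc 1 N = Finset.Ioc 0 N := rfl
  rw [h2, ← Finset.sum_filter_add_sum_filter_not (Finset.Ioc 0 N) Nat.Prime]
  ring

lemma thetaAP_tendsto (d : ℕ) [NeZero d] :
    Tendsto (fun N : ℕ => thetaAP d N / N) atTop (𝓝 ((d.totient : ℝ)⁻¹)) := by
  have h1 := (psiAP_tendsto d).comp (tendsto_natCast_atTop_atTop (R := ℝ))
  have h2 : Tendsto (fun N : ℕ => (psiAP d N - thetaAP d N) / N) atTop (𝓝 0) := by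
    obtain ⟨C, hC⟩ := Chebyshev.psi_sub_theta_le_mul_sqrt
    have h3 : Tendsto (fun N : ℕ => C * (√(N:ℝ))⁻¹) atTop (𝓝 0) := by
      have : Tendsto (fun N : ℕ => (√(N:ℝ))⁻¹) atTop (𝓝 0) :=
        tendsto_inv_atTop_zero.comp (Real.tendsto_sqrt_atTop.comp tendsto_natCast_atTop_atTop)
      simpa using this.const_mul C
    refine squeeze_zero' ?_ ?_ h3
    · refine Eventually.of_forall fun N => div_nonneg ?_ (by positivity)
      rw [psiAP_sub_thetaAP]
      exact Finset.sum_nonneg fun _ _ => ArithmeticFunction.vonMangoldt.residueClass_nonneg _ _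
    · filter_upwards [eventually_gt_atTop 0] with N hN
      have hN' : (0:ℝ) < N := by exact_mod_cast hN
      have h4 := hC N
      rw [Chebyshev.psi_sub_theta_eq_sum_not_prime, Nat.floor_natCast] at h4
      have h5 : psiAP d N - thetaAP d N ≤ C * √(N:ℝ) := by
        rw [psiAP_sub_thetaAP]
        exact (Finset.sum_le_sum fun n _ => ArithmeticFunction.vonMangoldt.residueClass_le _ _).trans h4
      rw [div_le_iff₀ hN', mul_assoc]
      refine h5.trans (le_of_eq ?_)
      congr 1
      have : 0 < √(N:ℝ) := Real.sqrt_pos.mpr hN'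
      rw [inv_mul_eq_div, Real.div_sqrt]
  have h3 := h1.sub h2
  rw [sub_zero] at h3
  refine h3.congr fun N => ?_
  simp only [Function.comp]
  ring

lemma cntAP_tendsto (d : ℕ) [NeZero d] :
    Tendsto (fun N : ℕ => (cntAP d N : ℝ) * Real.log N / N) atTop (𝓝 ((d.totient : ℝ)⁻¹)) := by
  have h2 : Tendsto (fun N : ℕ => ((cntAP d N : ℝ) * Real.log N - thetaAP d N) / N) atTop (𝓝 0) := by
    have hO := Chebyshev.primeCounting_sub_theta_div_log_isBigO
    obtain ⟨C, hC⟩ := hO.bound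
    have hC' := (tendsto_natCast_atTop_atTop (R := ℝ)).eventually hC
    have h3 : Tendsto (fun N : ℕ => C * (Real.log (N:ℝ))⁻¹) atTop (𝓝 0) := by
      have : Tendsto (fun N : ℕ => (Real.log (N:ℝ))⁻¹) atTop (𝓝 0) :=
        tendsto_inv_atTop_zero.comp (Real.tendsto_log_atTop.comp tendsto_natCast_atTop_atTop)
      simpa using this.const_mul C
    have hexp : ∀ N, (cntAP d N : ℝ) * Real.log N - thetaAP d N =
        ∑ p ∈ (Finset.filter Nat.Prime (Finset.Iic N)).filter (fun p => d ∣ p - 1),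
          (Real.log N - Real.log p) := by
      intro N
      rw [Finset.sum_sub_distrib, Finset.sum_const, nsmul_eq_mul]; rfl
    have hnn : ∀ N, ∀ p ∈ (Finset.filter Nat.Prime (Finset.Iic N)), 0 ≤ Real.log N - Real.log p := by
      intro N p hp
      simp only [Finset.mem_filter, Finset.mem_Iic] at hp
      rw [sub_nonneg]
      exact Real.log_le_log (by exact_mod_cast hp.2.pos) (by exact_mod_cast hp.1)
    refine squeeze_zero' ?_ ?_ h3
    · refine Eventually.of_forall fun N => div_nonneg ?_ (by positivity)
      rw [hexp]
      exact Finset.sum_nonneg fun p hp => hnn N p (Finset.filter_subset _ _ hp)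
    · filter_upwards [eventually_gt_atTop 1, hC'] with N hN hN2
      have hN' : (0:ℝ) < N := by exact_mod_cast (by omega : 0 < N)
      have hlog : 0 < Real.log N := Real.log_pos (by exact_mod_cast hN)
      rw [div_le_iff₀ hN', hexp]
      rw [Nat.floor_natCast, Real.norm_of_nonneg (r := (N:ℝ) / Real.log N ^ 2) (by positivity)] at hN2
      have h5 := (le_abs_self _).trans hN2
      have h6 : ∑ p ∈ (Finset.filter Nat.Prime (Finset.Iic N)), (Real.log N - Real.log p) =
          Nat.primeCounting N * Real.log N - Chebyshev.theta N := by
        rw [Finset.sum_sub_distrib, Finset.sum_const, nsmul_eq_mul, primesIic_card, Chebyshev.theta,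
          primesIic_eq, Nat.floor_natCast]
      calc _ ≤ ∑ p ∈ (Finset.filter Nat.Prime (Finset.Iic N)), (Real.log N - Real.log p) := by
            apply Finset.sum_le_sum_of_subset_of_nonneg (Finset.filter_subset _ _)
            intro p hp _
            exact hnn N p hp
        _ = (Nat.primeCounting N - Chebyshev.theta N / Real.log N) * Real.log N := by
            rw [h6]; field_simp
        _ ≤ (C * (N / Real.log N ^ 2)) * Real.log N := mul_le_mul_of_nonneg_right h5 hlog.le
        _ = _ := by field_simp
  have h3 := h2.add (thetaAP_tendsto d)
  rw [zero_add] at h3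
  refine h3.congr fun N => ?_
  ring

lemma cntAP_one (N : ℕ) : cntAP 1 N = Nat.primeCounting N := by
  simp [cntAP, primesIic_card]

lemma pi_tendsto :
    Tendsto (fun N : ℕ => (Nat.primeCounting N : ℝ) * Real.log N / N) atTop (𝓝 1) := by
  simpa [cntAP_one] using cntAP_tendsto 1

lemma cntAP_ratio (d : ℕ) [NeZero d] :
    Tendsto (fun N : ℕ => (cntAP d N : ℝ) / (Nat.primeCounting N : ℝ)) atTop (𝓝 ((d.totient : ℝ)⁻¹)) := by
  have h := (cntAP_tendsto d).div pi_tendsto one_ne_zero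
  rw [div_one] at h
  refine h.congr' ?_
  filter_upwards [eventually_gt_atTop 1] with N hN
  have hN' : (0:ℝ) < N := by exact_mod_cast (by omega : 0 < N)
  have hlog : 0 < Real.log N := Real.log_pos (by exact_mod_cast hN)
  simp only [Pi.div_apply]
  rw [div_div_div_cancel_right₀ hN'.ne', mul_div_mul_right _ _ hlog.ne']

end

section

lemma inner_sum_eq (F : ℕ → ℝ) {n m : ℕ} (hn : n ≠ 0) (hm : m ∣ n) :
    ∑ d ∈ (n / m).divisors, F (d * m) = ∑ e ∈ n.divisors, if m ∣ e then F e else 0 := by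
  have hm0 : 0 < m := Nat.pos_of_dvd_of_pos hm (Nat.pos_of_ne_zero hn)
  rw [← Finset.sum_filter]
  refine Finset.sum_nbij' (fun d => d * m) (fun e => e / m) ?_ ?_ ?_ ?_ ?_
  · intro d hd
    simp only [Finset.mem_filter, Nat.mem_divisors] at *
    refine ⟨⟨?_, hn⟩, Dvd.intro_left d rfl⟩
    obtain ⟨k, rfl⟩ := hm
    rw [Nat.mul_div_cancel_left _ hm0] at hd
    rw [mul_comm]
    exact mul_dvd_mul_left m hd.1
  · intro e he
    simp only [Finset.mem_filter, Nat.mem_divisors] at *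
    obtain ⟨⟨h1, -⟩, h2⟩ := he
    refine ⟨Nat.div_dvd_div h2 h1, ?_⟩
    exact (Nat.div_pos (Nat.le_of_dvd (Nat.pos_of_ne_zero hn) hm) hm0).ne'
  · intro d _
    exact Nat.mul_div_cancel _ hm0
  · intro e he
    simp only [Finset.mem_filter] at he
    exact Nat.div_mul_cancel he.2
  · intro d _; rfl

lemma sum_totient_real (n : ℕ) : ∑ m ∈ n.divisors, (m.totient : ℝ) = n := by
  rw [← Nat.cast_sum, Nat.sum_totient]

lemma w_eq {n : ℕ} (hn : n ≠ 0) :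
    (∑ m ∈ n.divisors, (m.totient : ℝ) *
      (∑ d ∈ (n / m).divisors, ((d * m).totient : ℝ) / ((d * m : ℕ) : ℝ)) ^ 2) / (n : ℝ) =
    ∑ d ∈ n.divisors, (d.totient : ℝ) / (d : ℝ) ^ 2 := by
  have hn' : (n : ℝ) ≠ 0 := by exact_mod_cast hn
  set F : ℕ → ℝ := fun e => (e.totient : ℝ) / (e : ℝ) with hF
  -- step 1
  have s1 : ∑ m ∈ n.divisors, (m.totient : ℝ) *
      (∑ d ∈ (n / m).divisors, ((d * m).totient : ℝ) / ((d * m : ℕ) : ℝ)) ^ 2 =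
      ∑ e ∈ n.divisors, ∑ f ∈ n.divisors, F e * F f * (Nat.gcd e f : ℝ) := by
    calc _ = ∑ m ∈ n.divisors, ∑ e ∈ n.divisors, ∑ f ∈ n.divisors,
          F e * F f * (if m ∣ e ∧ m ∣ f then (m.totient : ℝ) else 0) := by
          apply Finset.sum_congr rfl
          intro m hm
          rw [inner_sum_eq F hn (Nat.dvd_of_mem_divisors hm), sq, Finset.sum_mul_sum, Finset.mul_sum]
          apply Finset.sum_congr rfl
          intro e _
          rw [Finset.mul_sum]
          apply Finset.sum_congr rfl
          intro f _
          by_cases h1 : m ∣ e <;> by_cases h2 : m ∣ f <;> simp [h1, h2]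
          ring
      _ = ∑ e ∈ n.divisors, ∑ f ∈ n.divisors, ∑ m ∈ n.divisors,
          F e * F f * (if m ∣ e ∧ m ∣ f then (m.totient : ℝ) else 0) := by
          rw [Finset.sum_comm]
          apply Finset.sum_congr rfl
          intro e _
          rw [Finset.sum_comm]
      _ = _ := by
          apply Finset.sum_congr rfl
          intro e he
          apply Finset.sum_congr rfl
          intro f hf
          rw [← Finset.mul_sum, ← Finset.sum_filter, ← sum_totient_real]
          congr 1
          apply Finset.sum_congr _ fun _ _ => rfl
          ext m
          simp only [Finset.mem_filter, Nat.mem_divisors, ← Nat.dvd_gcd_iff] at *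
          have hg : Nat.gcd e f ≠ 0 := by
            intro h
            rw [Nat.gcd_eq_zero_iff] at h
            rw [h.1, zero_dvd_iff] at he
            exact hn he.1
          exact ⟨fun h => ⟨h.2, hg⟩, fun h => ⟨⟨(h.1.trans (Nat.gcd_dvd_left e f)).trans he.1, hn⟩, h.1⟩⟩
  -- step 2
  have s2 : ∑ e ∈ n.divisors, ∑ f ∈ n.divisors, F e * F f * (Nat.gcd e f : ℝ) =
      ∑ N ∈ n.divisors, ((n / N).totient : ℝ) * (N : ℝ) ^ 2 / n := by
    calc _ = ∑ e ∈ n.divisors, ∑ f ∈ n.divisors, ∑ N ∈ n.divisors,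
          ((e.totient : ℝ) * f.totient) * (if e ∣ N ∧ f ∣ N then ((n / N).totient : ℝ) / n else 0) := by
          apply Finset.sum_congr rfl
          intro e he
          apply Finset.sum_congr rfl
          intro f hf
          simp only [Nat.mem_divisors] at he hf
          have he0 : (e : ℝ) ≠ 0 := by
            intro h
            have : e = 0 := by exact_mod_cast h
            rw [this, zero_dvd_iff] at he; exact hn he.1
          have hf0 : (f : ℝ) ≠ 0 := by
            intro h
            have : f = 0 := by exact_mod_cast h
            rw [this, zero_dvd_iff] at hf; exact hn hf.1
          have hl : Nat.lcm e f ∣ n := Nat.lcm_dvd he.1 hf.1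
          have hl0 : 0 < Nat.lcm e f := Nat.pos_of_dvd_of_pos hl (Nat.pos_of_ne_zero hn)
          have hl0' : ((Nat.lcm e f : ℕ) : ℝ) ≠ 0 := by exact_mod_cast hl0.ne'
          have hgl : (Nat.gcd e f : ℝ) * (Nat.lcm e f : ℝ) = e * f := by
            exact_mod_cast Nat.gcd_mul_lcm e f
          have key : ∑ N ∈ n.divisors, (if e ∣ N ∧ f ∣ N then ((n / N).totient : ℝ) / n else 0) =
              ((Nat.lcm e f : ℕ) : ℝ)⁻¹ := by
            simp_rw [← Nat.lcm_dvd_iff]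
            have h1 := inner_sum_eq (fun N => ((n / N).totient : ℝ) / n) hn hl
            rw [← h1, ← Finset.sum_div]
            have h2 : ∑ d ∈ (n / Nat.lcm e f).divisors, ((n / (d * Nat.lcm e f)).totient : ℝ) =
                ∑ d ∈ (n / Nat.lcm e f).divisors, (((n / Nat.lcm e f) / d).totient : ℝ) := by
              apply Finset.sum_congr rfl
              intro d _
              rw [mul_comm, Nat.div_div_eq_div_mul]
            rw [h2, Nat.sum_div_divisors (n / Nat.lcm e f) (fun k => (k.totient : ℝ)), sum_totient_real,
              Nat.cast_div hl hl0']
            field_simp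
          rw [← Finset.mul_sum, key]
          simp only [hF]
          field_simp
          linear_combination ((e.totient : ℝ) * (f.totient : ℝ)) * hgl
      _ = ∑ N ∈ n.divisors, ∑ e ∈ n.divisors, ∑ f ∈ n.divisors,
          ((e.totient : ℝ) * f.totient) * (if e ∣ N ∧ f ∣ N then ((n / N).totient : ℝ) / n else 0) := by
          symm
          rw [Finset.sum_comm]
          apply Finset.sum_congr rfl
          intro e _
          rw [Finset.sum_comm]
      _ = _ := by
          apply Finset.sum_congr rfl
          intro N hN
          have h3 : ∑ e ∈ n.divisors, (if e ∣ N then (e.totient : ℝ) else 0) = N := by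
            rw [← Finset.sum_filter, ← sum_totient_real]
            apply Finset.sum_congr _ fun _ _ => rfl
            ext m
            simp only [Finset.mem_filter, Nat.mem_divisors] at *
            have : N ≠ 0 := by
              rintro rfl
              exact hn (zero_dvd_iff.mp hN.1)
            exact ⟨fun h => ⟨h.2, this⟩, fun h => ⟨⟨h.1.trans hN.1, hn⟩, h.1⟩⟩
          calc _ = ∑ e ∈ n.divisors, ∑ f ∈ n.divisors,
                ((n / N).totient : ℝ) / n * ((if e ∣ N then (e.totient : ℝ) else 0) *
                  (if f ∣ N then (f.totient : ℝ) else 0)) := by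
                apply Finset.sum_congr rfl
                intro e _
                apply Finset.sum_congr rfl
                intro f _
                by_cases h1 : e ∣ N <;> by_cases h2 : f ∣ N <;> simp [h1, h2]
                ring
            _ = ((n / N).totient : ℝ) / n * ((N : ℝ) * N) := by
                simp_rw [← Finset.mul_sum]
                rw [← Finset.sum_mul, h3]
            _ = _ := by ring
  rw [s1, s2, ← Nat.sum_div_divisors n (fun d => (d.totient : ℝ) / (d : ℝ) ^ 2), Finset.sum_div]
  apply Finset.sum_congr rfl
  intro N hN
  simp only [Nat.mem_divisors] at hN
  have hN0 : (N : ℝ) ≠ 0 := by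
    intro h
    have : N = 0 := by exact_mod_cast h
    rw [this, zero_dvd_iff] at hN; exact hn hN.1
  rw [Nat.cast_div hN.1 hN0]
  field_simp

end

section

open Finset

lemma factorial_dvd_prod (d n : ℕ) :
    n.factorial ∣ (∏ k ∈ Icc 1 n, (k * d + 1)) * d ^ n := by
  rw [Nat.dvd_iff_prime_pow_dvd_dvd]
  intro q k hq hk
  by_cases hqd : q ∣ d
  · -- q ∣ d
    apply Dvd.dvd.mul_left
    have hkn : k ≤ n := by
      have h1 : k ≤ (n.factorial).factorization q :=
        (hq.pow_dvd_iff_le_factorization (Nat.factorial_ne_zero n)).mp hk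
      have h2 : (n.factorial).factorization q ≤ n := by
        exact (Nat.factorization_factorial_le_div_pred hq n).trans (Nat.div_le_self _ _)
      omega
    exact (pow_dvd_pow q hkn).trans (pow_dvd_pow_of_dvd hqd n)
  · apply Dvd.dvd.mul_right
    have hc : Nat.Coprime d (q ^ k) := by
      apply Nat.Coprime.pow_right
      exact ((Nat.Prime.coprime_iff_not_dvd hq).mpr hqd).symm
    set b := q ^ k with hb
    rw [← ZMod.natCast_eq_zero_iff]
    set u : (ZMod b)ˣ := ZMod.unitOfCoprime d hc with hu
    have hu1 : (u : ZMod b) = d := rfl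
    set e : ℕ := ((u⁻¹ : (ZMod b)ˣ) : ZMod b).val with he
    have hbne : NeZero b := ⟨(pow_pos hq.pos k).ne'⟩
    have he1 : (e : ZMod b) = ((u⁻¹ : (ZMod b)ˣ) : ZMod b) := by
      rw [he, ZMod.natCast_zmod_val]
    have hed : (d : ZMod b) * e = 1 := by
      rw [he1, ← hu1, Units.mul_inv]
    have h1 : ((∏ k ∈ Icc 1 n, (k * d + 1) : ℕ) : ZMod b) =
        (d : ZMod b) ^ n * (((e + 1).ascFactorial n : ℕ) : ZMod b) := by
      have h2 : (e + 1).ascFactorial n = ∏ k ∈ Icc 1 n, (e + k) := by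
        rw [Nat.ascFactorial_eq_prod_range, ← Finset.Ico_add_one_right_eq_Icc, Finset.prod_Ico_eq_prod_range]
        simp [add_assoc]
      rw [h2]
      push_cast
      have hcard : (d : ZMod b) ^ n = ∏ _k ∈ Icc 1 n, (d : ZMod b) := by simp
      rw [hcard, ← Finset.prod_mul_distrib]
      apply Finset.prod_congr rfl
      intro k _
      linear_combination (-1 : ZMod b) * hed
    rw [h1]
    have h3 : b ∣ (e + 1).ascFactorial n := hk.trans (Nat.factorial_dvd_ascFactorial _ _)
    rw [(ZMod.natCast_eq_zero_iff _ _).mpr h3, mul_zero]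

/-- primes `p ≤ N`, `p ≡ 1 mod d`, `p > N / d`. -/
def bigS (d N : ℕ) : Finset ℕ :=
  (((Finset.filter Nat.Prime (Finset.Iic N)).filter (fun p => d ∣ p - 1))).filter (fun p => N / d < p)

lemma bigS_pow_le (d N : ℕ) (hd : d ≠ 0) :
    (N / d) ^ (bigS d N).card ≤ (d * (d + 1)) ^ (N / d) := by
  set n := N / d with hn
  obtain ⟨Q, hQ⟩ := factorial_dvd_prod d n
  have hmem : ∀ p ∈ bigS d N, p.Prime ∧ p ≤ N ∧ d ∣ p - 1 ∧ n < p := by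
    intro p hp
    simp only [bigS, Finset.mem_filter, Finset.mem_Iic] at hp
    tauto
  have hdvdP : (∏ p ∈ bigS d N, p) ∣ ∏ k ∈ Icc 1 n, (k * d + 1) := by
    apply Finset.prod_primes_dvd
    · intro p hp
      exact (hmem p hp).1.prime
    · intro p hp
      obtain ⟨h1, h2, ⟨k, hk⟩, h4⟩ := hmem p hp
      have h1' := h1.two_le
      have hpk : p = k * d + 1 := by
        rw [mul_comm k d]; omega
      have hk1 : k ∈ Icc 1 n := by
        rw [Finset.mem_Icc]
        constructor
        · rcases Nat.eq_zero_or_pos k with h | h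
          · subst h; omega
          · exact h
        · rw [hn, Nat.le_div_iff_mul_le (Nat.pos_of_ne_zero hd)]
          omega
      have h5 := Finset.dvd_prod_of_mem (fun k => k * d + 1) hk1
      simpa [← hpk] using h5
  have hcop : Nat.Coprime (∏ p ∈ bigS d N, p) n.factorial := by
    apply Nat.Coprime.prod_left
    intro p hp
    obtain ⟨h1, h2, h3, h4⟩ := hmem p hp
    rw [h1.coprime_iff_not_dvd, h1.dvd_factorial]
    omega
  have hdQ : (∏ p ∈ bigS d N, p) ∣ Q := by
    apply hcop.dvd_of_dvd_mul_left
    rw [← hQ]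
    exact hdvdP.mul_right _
  have hPpos : 0 < (∏ k ∈ Icc 1 n, (k * d + 1)) * d ^ n := by
    apply Nat.mul_pos
    · apply Finset.prod_pos
      intros; omega
    · exact pow_pos (Nat.pos_of_ne_zero hd) n
  have hQpos : 0 < Q := by
    rcases Nat.eq_zero_or_pos Q with h | h
    · rw [hQ, h] at hPpos; omega
    · exact h
  have hPle : ∏ k ∈ Icc 1 n, (k * d + 1) ≤ n.factorial * (d + 1) ^ n := by
    have h1 : n.factorial * (d + 1) ^ n = ∏ k ∈ Icc 1 n, (k * (d + 1)) := by
      rw [Finset.prod_mul_distrib, ← Finset.Ico_add_one_right_eq_Icc, Finset.prod_Ico_id_eq_factorial]; simp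
    rw [h1]
    apply Finset.prod_le_prod'
    intro k hk
    have := (Finset.mem_Icc.mp hk).1
    rw [Nat.mul_add]; omega
  have hQle : Q ≤ (d * (d + 1)) ^ n := by
    apply Nat.le_of_mul_le_mul_left _ (Nat.factorial_pos n)
    rw [← hQ, mul_pow]
    calc _ ≤ n.factorial * (d + 1) ^ n * d ^ n := Nat.mul_le_mul_right _ hPle
      _ = _ := by ring
  calc n ^ (bigS d N).card ≤ ∏ p ∈ bigS d N, p := by
        apply Finset.pow_card_le_prod
        intro p hp
        exact (hmem p hp).2.2.2.le
    _ ≤ Q := Nat.le_of_dvd hQpos hdQ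
    _ ≤ _ := hQle

lemma cntAP_le (d N : ℕ) : cntAP d N ≤ Nat.primeCounting (N / d) + (bigS d N).card := by
  rw [← primesIic_card]
  unfold cntAP bigS
  rw [← Finset.card_filter_add_card_filter_not (s := (Finset.filter Nat.Prime (Finset.Iic N)).filter (fun p => d ∣ p - 1)) (fun p => N / d < p), add_comm]
  gcongr
  intro p hp
  simp only [Finset.mem_filter, Finset.mem_Iic] at hp ⊢
  exact ⟨by omega, hp.1.1.2⟩

lemma cntAP_le_div (d N : ℕ) (hd : d ≠ 0) : cntAP d N ≤ N / d := by
  unfold cntAP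
  have h : ((Finset.filter Nat.Prime (Finset.Iic N)).filter (fun p => d ∣ p - 1)) ⊆
      (Icc 1 (N / d)).image (fun k => d * k + 1) := by
    intro p hp
    simp only [Finset.mem_filter, Finset.mem_Iic] at hp
    obtain ⟨⟨h1, h2⟩, k, hk⟩ := hp
    have := h2.two_le
    simp only [Finset.mem_image, Finset.mem_Icc]
    refine ⟨k, ⟨?_, ?_⟩, by omega⟩
    · rcases Nat.eq_zero_or_pos k with h | h
      · subst h; omega
      · exact h
    · rw [Nat.le_div_iff_mul_le (Nat.pos_of_ne_zero hd), mul_comm]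
      omega
  exact (Finset.card_le_card h).trans (Finset.card_image_le.trans (by simp))

lemma pi_log_bound : ∃ C : ℝ, 0 ≤ C ∧ ∀ n : ℕ, (Nat.primeCounting n : ℝ) * Real.log n ≤ C * n := by
  obtain ⟨C, hC⟩ := pi_tendsto.bddAbove_range
  refine ⟨max C 0, le_max_right _ _, fun n => ?_⟩
  rcases Nat.eq_zero_or_pos n with h | h
  · subst h; simp
  · have h1 := hC ⟨n, rfl⟩
    have hn : (0:ℝ) < n := by exact_mod_cast h
    have h2 := (div_le_iff₀ hn).mp (h1.trans (le_max_left C 0))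
    exact h2

lemma cntAP_log_bound : ∃ C : ℝ, 0 ≤ C ∧ ∀ d N : ℕ, d ≠ 0 → d * d ≤ N → 4 ≤ N →
    (cntAP d N : ℝ) * Real.log N ≤ 3 * (C + Real.log (d * (d + 1))) * ((N : ℝ) / d) := by
  obtain ⟨C, hC0, hC⟩ := pi_log_bound
  refine ⟨C, hC0, fun d N hd hdN hN => ?_⟩
  set n := N / d with hn
  have hdpos : 0 < d := Nat.pos_of_ne_zero hd
  have hdn : d ≤ n := by rw [hn, Nat.le_div_iff_mul_le hdpos]; exact hdN
  have hn2 : 2 ≤ n := by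
    rcases Nat.lt_or_ge d 2 with h | h
    · have : d = 1 := by omega
      rw [hn, this]; simp; omega
    · omega
  have hNlt : N < d * (n + 1) := by
    rw [mul_comm, hn]; exact Nat.lt_mul_of_div_lt (Nat.lt_succ_self _) hdpos
  have hN3 : N ≤ n ^ 3 := by
    have : d * (n + 1) ≤ n * (n + n) := Nat.mul_le_mul hdn (by omega)
    nlinarith
  have hnR : (2 : ℝ) ≤ n := by exact_mod_cast hn2
  have hlogn : 0 < Real.log n := Real.log_pos (by linarith)
  have hlog : Real.log N ≤ 3 * Real.log n := by
    have : Real.log N ≤ Real.log ((n : ℝ) ^ 3) := by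
      apply Real.log_le_log
      · have : 0 < N := by omega
        exact_mod_cast this
      · exact_mod_cast hN3
    rwa [Real.log_pow, Nat.cast_ofNat] at this
  have hS : ((bigS d N).card : ℝ) * Real.log n ≤ n * Real.log (d * (d + 1)) := by
    have h1 := bigS_pow_le d N hd
    rw [← hn] at h1
    have h2 : ((n : ℝ)) ^ (bigS d N).card ≤ ((d : ℝ) * (d + 1)) ^ n := by exact_mod_cast h1
    have h3 := Real.log_le_log (by positivity) h2
    rwa [Real.log_pow, Real.log_pow] at h3
  have hcnt : (cntAP d N : ℝ) ≤ Nat.primeCounting n + (bigS d N).card := by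
    exact_mod_cast cntAP_le d N
  have hnN : (n : ℝ) ≤ (N : ℝ) / d := Nat.cast_div_le
  have hL : 0 ≤ Real.log ((d : ℝ) * (d + 1)) := by
    apply Real.log_nonneg
    have : (1 : ℝ) ≤ d := by exact_mod_cast hdpos
    nlinarith
  calc (cntAP d N : ℝ) * Real.log N ≤ cntAP d N * (3 * Real.log n) := by gcongr
    _ ≤ (Nat.primeCounting n + (bigS d N).card) * (3 * Real.log n) := by gcongr
    _ = 3 * (Nat.primeCounting n * Real.log n + (bigS d N).card * Real.log n) := by ring
    _ ≤ 3 * (C * n + n * Real.log (d * (d + 1))) := by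
        have := hC n
        gcongr
    _ = 3 * (C + Real.log (d * (d + 1))) * n := by ring
    _ ≤ _ := by gcongr

end

section

open Filter Topology

lemma sum_eq_cntAP (N : ℕ) :
    ∑ p ∈ Finset.filter Nat.Prime (Finset.Iic N),
      (∑ m ∈ (p - 1).divisors, (m.totient : ℝ) *
        (∑ d ∈ ((p - 1) / m).divisors, ((d * m).totient : ℝ) / ((d * m : ℕ) : ℝ)) ^ 2) /
        ((p - 1 : ℕ) : ℝ) =
    ∑ d ∈ Finset.Icc 1 N, (d.totient : ℝ) / (d : ℝ) ^ 2 * cntAP d N := by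
  have h1 : ∀ p ∈ Finset.filter Nat.Prime (Finset.Iic N),
      (∑ m ∈ (p - 1).divisors, (m.totient : ℝ) *
        (∑ d ∈ ((p - 1) / m).divisors, ((d * m).totient : ℝ) / ((d * m : ℕ) : ℝ)) ^ 2) /
        ((p - 1 : ℕ) : ℝ) =
      ∑ d ∈ Finset.Icc 1 N, if d ∣ p - 1 then (d.totient : ℝ) / (d : ℝ) ^ 2 else 0 := by
    intro p hp
    simp only [Finset.mem_filter, Finset.mem_Iic] at hp
    have h2 := hp.2.two_le
    have hne : p - 1 ≠ 0 := by omega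
    rw [w_eq hne, ← Finset.sum_filter]
    apply Finset.sum_congr _ (fun _ _ => rfl)
    ext d
    simp only [Nat.mem_divisors, Finset.mem_filter, Finset.mem_Icc]
    constructor
    · rintro ⟨h, -⟩
      have := Nat.le_of_dvd (by omega) h
      have := Nat.pos_of_dvd_of_pos h (by omega)
      exact ⟨⟨by omega, by omega⟩, h⟩
    · rintro ⟨-, h⟩
      exact ⟨h, hne⟩
  rw [Finset.sum_congr rfl h1, Finset.sum_comm]
  apply Finset.sum_congr rfl
  intro d _
  rw [← Finset.sum_filter, Finset.sum_const, nsmul_eq_mul, mul_comm]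
  rfl

lemma hfun_le (d : ℕ) : (d.totient : ℝ) / (d : ℝ) ^ 2 ≤ 1 / d := by
  rcases Nat.eq_zero_or_pos d with h | h
  · subst h; simp
  · have hd : (0 : ℝ) < d := by exact_mod_cast h
    have : (d.totient : ℝ) ≤ d := by exact_mod_cast Nat.totient_le d
    rw [div_le_div_iff₀ (by positivity) hd]
    nlinarith

lemma pi_lower : ∀ᶠ N : ℕ in atTop, 4 ≤ N ∧ (0 : ℝ) < Nat.primeCounting N ∧
    (N : ℝ) ≤ 2 * Real.log N * Nat.primeCounting N := by
  have h1 : ∀ᶠ N : ℕ in atTop, (1 / 2 : ℝ) < (Nat.primeCounting N : ℝ) * Real.log N / N :=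
    pi_tendsto.eventually (lt_mem_nhds (by norm_num))
  filter_upwards [h1, eventually_ge_atTop 4] with N hN h4
  have hN0 : (0 : ℝ) < N := by
    have : 0 < N := by omega
    exact_mod_cast this
  rw [lt_div_iff₀ hN0] at hN
  refine ⟨h4, ?_, by linarith⟩
  by_contra hcon
  have h0 : (Nat.primeCounting N : ℝ) = 0 := le_antisymm (not_lt.mp hcon) (Nat.cast_nonneg _)
  rw [h0] at hN
  linarith

/-- Main terms. -/
noncomputable def mainT (N d : ℕ) : ℝ :=
  if d ≠ 0 ∧ d * d ≤ N then (d.totient : ℝ) / (d : ℝ) ^ 2 * cntAP d N / Nat.primeCounting N else 0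

lemma mainT_tendsto (d : ℕ) : Tendsto (fun N => mainT N d) atTop (𝓝 (1 / (d : ℝ) ^ 2)) := by
  rcases Nat.eq_zero_or_pos d with h | h
  · subst h; simp [mainT]
  · have hne : NeZero d := ⟨h.ne'⟩
    have h1 := (cntAP_ratio d).const_mul ((d.totient : ℝ) / (d : ℝ) ^ 2)
    have h2 : (d.totient : ℝ) / (d : ℝ) ^ 2 * (d.totient : ℝ)⁻¹ = 1 / (d : ℝ) ^ 2 := by
      have ht : (d.totient : ℝ) ≠ 0 := by exact_mod_cast (Nat.totient_pos.mpr h).ne'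
      field_simp
    rw [h2] at h1
    apply h1.congr'
    filter_upwards [eventually_ge_atTop (d * d)] with N hN
    rw [mainT, if_pos ⟨h.ne', hN⟩, mul_div_assoc]

lemma log_dd (d : ℕ) (hd : d ≠ 0) :
    Real.log ((d : ℝ) * (d + 1)) ≤ 1 + 4 * (d : ℝ) ^ (1 / 2 : ℝ) := by
  have h1 : (1 : ℝ) ≤ d := by exact_mod_cast Nat.pos_of_ne_zero hd
  have h2 : Real.log ((d : ℝ) * (d + 1)) ≤ Real.log (2 * (d : ℝ) ^ 2) := by
    apply Real.log_le_log (by positivity)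
    nlinarith
  rw [Real.log_mul (x := 2) (y := (d : ℝ) ^ 2) (by norm_num) (by positivity), Real.log_pow] at h2
  have h3 := Real.log_le_rpow_div (by linarith : (0 : ℝ) ≤ d) (by norm_num : (0 : ℝ) < 1 / 2)
  have h4 := Real.log_two_lt_d9
  push_cast at h2
  linarith

lemma mainT_tsum : Tendsto (fun N => ∑' d, mainT N d) atTop (𝓝 (Real.pi ^ 2 / 6)) := by
  obtain ⟨C, hC0, hC⟩ := cntAP_log_bound
  rw [← hasSum_zeta_two.tsum_eq]
  apply tendsto_tsum_of_dominated_convergence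
    (bound := fun d : ℕ => 6 * ((C + 1) * (1 / (d : ℝ) ^ 2) + 4 * (1 / (d : ℝ) ^ (3 / 2 : ℝ))))
  · apply Summable.mul_left
    apply Summable.add
    · exact hasSum_zeta_two.summable.mul_left _
    · exact (Real.summable_one_div_nat_rpow.mpr (by norm_num)).mul_left _
  · exact mainT_tendsto
  · filter_upwards [pi_lower] with N hN d
    obtain ⟨h4, hpi, hNpi⟩ := hN
    rw [mainT]
    split_ifs with h
    · obtain ⟨hd, hdN⟩ := h
      have hd0 : (0 : ℝ) < d := by exact_mod_cast Nat.pos_of_ne_zero hd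
      have hN0 : (0 : ℝ) < N := by
        have : 0 < N := by omega
        exact_mod_cast this
      rw [Real.norm_of_nonneg (by positivity)]
      have hb := hC d N hd hdN h4
      have hl := log_dd d hd
      have hlogN : 0 < Real.log N := Real.log_pos (by exact_mod_cast (by omega : 1 < N))
      have h5 : (cntAP d N : ℝ) / Nat.primeCounting N ≤
          6 * (C + Real.log (d * (d + 1))) / d := by
        rw [div_le_div_iff₀ hpi hd0]
        have e1 : (cntAP d N : ℝ) * Real.log N * d ≤ 3 * (C + Real.log (d * (d + 1))) * N := by
          calc _ ≤ 3 * (C + Real.log (d * (d + 1))) * ((N : ℝ) / d) * d := by gcongr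
            _ = _ := by field_simp
        have hL : 0 ≤ C + Real.log ((d : ℝ) * (d + 1)) := by
          have : 0 ≤ Real.log ((d : ℝ) * (d + 1)) := by
            apply Real.log_nonneg
            have : (1 : ℝ) ≤ d := by exact_mod_cast Nat.pos_of_ne_zero hd
            nlinarith
          linarith
        have e2 := mul_le_mul_of_nonneg_left hNpi (by positivity : 0 ≤ 3 * (C + Real.log ((d : ℝ) * (d + 1))))
        apply le_of_mul_le_mul_right _ hlogN
        calc (cntAP d N : ℝ) * d * Real.log N = (cntAP d N : ℝ) * Real.log N * d := by ring
          _ ≤ _ := e1.trans e2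
          _ = _ := by ring
      have h6 : (d : ℝ) ^ (3 / 2 : ℝ) * (d : ℝ) ^ (1 / 2 : ℝ) = (d : ℝ) ^ 2 := by
        rw [← Real.rpow_add hd0]; norm_num
      have h7 : (d : ℝ) ^ (1 / 2 : ℝ) / (d : ℝ) ^ 2 = 1 / (d : ℝ) ^ (3 / 2 : ℝ) := by
        rw [← h6]
        have : 0 < (d : ℝ) ^ (1 / 2 : ℝ) := by positivity
        have : 0 < (d : ℝ) ^ (3 / 2 : ℝ) := by positivity
        field_simp
      calc (d.totient : ℝ) / (d : ℝ) ^ 2 * cntAP d N / Nat.primeCounting N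
          = (d.totient : ℝ) / (d : ℝ) ^ 2 * (cntAP d N / Nat.primeCounting N) := by ring
        _ ≤ 1 / d * (6 * (C + (1 + 4 * (d : ℝ) ^ (1 / 2 : ℝ))) / d) := by
            apply mul_le_mul (hfun_le d) _ (by positivity) (by positivity)
            apply h5.trans
            gcongr
        _ = 6 * ((C + 1) * (1 / (d : ℝ) ^ 2) + 4 * ((d : ℝ) ^ (1 / 2 : ℝ) / (d : ℝ) ^ 2)) := by
            field_simp
            ring
        _ = _ := by rw [h7]
    · simp only [norm_zero]
      positivity

lemma mainT_tsum_eq (N : ℕ) : ∑' d, mainT N d =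
    ∑ d ∈ (Finset.Icc 1 N).filter (fun d => d * d ≤ N),
      (d.totient : ℝ) / (d : ℝ) ^ 2 * cntAP d N / Nat.primeCounting N := by
  rw [tsum_eq_sum (s := (Finset.Icc 1 N).filter (fun d => d * d ≤ N))]
  · apply Finset.sum_congr rfl
    intro d hd
    simp only [Finset.mem_filter, Finset.mem_Icc] at hd
    rw [mainT, if_pos ⟨by omega, hd.2⟩]
  · intro d hd
    rw [mainT, if_neg]
    rintro ⟨h1, h2⟩
    apply hd
    simp only [Finset.mem_filter, Finset.mem_Icc]
    refine ⟨⟨by omega, ?_⟩, h2⟩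
    nlinarith [Nat.pos_of_ne_zero h1]

lemma tail_tendsto : Tendsto (fun N : ℕ =>
    ∑ d ∈ (Finset.Icc 1 N).filter (fun d => ¬ d * d ≤ N),
      (d.totient : ℝ) / (d : ℝ) ^ 2 * cntAP d N / Nat.primeCounting N) atTop (𝓝 0) := by
  have hlim : Tendsto (fun N : ℕ => 4 * (Real.log N / (N : ℝ) ^ (1 / 2 : ℝ))) atTop (𝓝 0) := by
    have h := (isLittleO_log_rpow_atTop (by norm_num : (0 : ℝ) < 1 / 2)).tendsto_div_nhds_zero
    have := (h.comp tendsto_natCast_atTop_atTop).const_mul (4 : ℝ)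
    simpa using this
  apply squeeze_zero' _ _ hlim
  · filter_upwards with N
    apply Finset.sum_nonneg
    intros; positivity
  · filter_upwards [pi_lower] with N hN
    obtain ⟨h4, hpi, hNpi⟩ := hN
    have hN0 : (0 : ℝ) < N := by
      have : 0 < N := by omega
      exact_mod_cast this
    have hlogN : 0 < Real.log N := Real.log_pos (by exact_mod_cast (by omega : 1 < N))
    set r := Nat.sqrt N with hr
    have hr1 : 1 ≤ r := by rw [hr, Nat.le_sqrt]; omega
    have hr0 : (0 : ℝ) < r := by exact_mod_cast hr1
    have hrN : r ≤ N := Nat.sqrt_le_self N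
    have hsq : (N : ℝ) ^ (1 / 2 : ℝ) ≤ 2 * r := by
      rw [← Real.sqrt_eq_rpow, Real.sqrt_le_left (by positivity)]
      have h1 : N < (r + 1) * (r + 1) := Nat.lt_succ_sqrt N
      have h2 : N ≤ (2 * r) ^ 2 := by nlinarith
      exact_mod_cast h2
    have hsub : (Finset.Icc 1 N).filter (fun d => ¬ d * d ≤ N) ⊆ Finset.Ioc r N := by
      intro d hd
      simp only [Finset.mem_filter, Finset.mem_Icc, Finset.mem_Ioc] at hd ⊢
      refine ⟨?_, hd.1.2⟩
      rw [hr, Nat.sqrt_lt]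
      omega
    calc _ ≤ ∑ d ∈ (Finset.Icc 1 N).filter (fun d => ¬ d * d ≤ N),
            (N : ℝ) / Nat.primeCounting N * ((d : ℝ) ^ 2)⁻¹ := by
          apply Finset.sum_le_sum
          intro d hd
          simp only [Finset.mem_filter, Finset.mem_Icc] at hd
          have hd0 : (0 : ℝ) < d := by exact_mod_cast hd.1.1
          have h1 : (cntAP d N : ℝ) ≤ N / d := by
            have : (cntAP d N : ℝ) ≤ ((N / d : ℕ) : ℝ) := by
              exact_mod_cast cntAP_le_div d N (by omega)
            exact this.trans Nat.cast_div_le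
          calc _ ≤ (1 / d) * (N / d) / (Nat.primeCounting N : ℝ) := by
                have h0 := hfun_le d
                apply div_le_div_of_nonneg_right _ hpi.le
                exact mul_le_mul h0 h1 (by positivity) (by positivity)
            _ = _ := by field_simp
      _ ≤ ∑ d ∈ Finset.Ioc r N, (N : ℝ) / Nat.primeCounting N * ((d : ℝ) ^ 2)⁻¹ := by
          apply Finset.sum_le_sum_of_subset_of_nonneg hsub
          intros; positivity
      _ = (N : ℝ) / Nat.primeCounting N * ∑ d ∈ Finset.Ioc r N, ((d : ℝ) ^ 2)⁻¹ := by
          rw [Finset.mul_sum]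
      _ ≤ (2 * Real.log N) * (r : ℝ)⁻¹ := by
          apply mul_le_mul _ _ (Finset.sum_nonneg fun _ _ => by positivity) (by positivity)
          · rw [div_le_iff₀ hpi]; exact hNpi
          · have := sum_Ioc_inv_sq_le_sub (α := ℝ) (k := r) (n := N) (by omega) hrN
            have h0 : (0 : ℝ) ≤ (N : ℝ)⁻¹ := by positivity
            linarith
      _ ≤ _ := by
          have hp : 0 < (N : ℝ) ^ (1 / 2 : ℝ) := by positivity
          rw [← div_eq_mul_inv, ← mul_div_assoc, div_le_div_iff₀ hr0 hp]
          nlinarith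

lemma average_tendsto : Tendsto (fun N : ℕ => (1 / (Nat.primeCounting N : ℝ)) *
    ∑ p ∈ Finset.filter Nat.Prime (Finset.Iic N),
      (∑ m ∈ (p - 1).divisors, (m.totient : ℝ) *
        (∑ d ∈ ((p - 1) / m).divisors, ((d * m).totient : ℝ) / ((d * m : ℕ) : ℝ)) ^ 2) /
        ((p - 1 : ℕ) : ℝ)) atTop (𝓝 (Real.pi ^ 2 / 6)) := by
  have h := mainT_tsum.add tail_tendsto
  rw [add_zero] at h
  apply h.congr
  intro N
  rw [mainT_tsum_eq, Finset.sum_filter_add_sum_filter_not, sum_eq_cntAP, Finset.mul_sum]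
  apply Finset.sum_congr rfl
  intro d _
  ring

end

/-- With `w(p) = Σ_{m ∣ p-1} φ(m) (Σ_{d ∣ (p-1)/m} φ(dm)/(dm))²`, for all sufficiently
large `x` the average `(1/π(x)) Σ_{p ≤ x} w(p)/(p-1)` lies between `1.444` and `3.422`. -/
theorem average_w_bounds :
    ∃ x₀ : ℕ, ∀ x : ℕ, x₀ ≤ x →
      (1.444 : ℝ) ≤ (1 / (Nat.primeCounting x : ℝ)) *
          ∑ p ∈ Finset.filter Nat.Prime (Finset.Iic x),
            (∑ m ∈ (p - 1).divisors, (m.totient : ℝ) *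
              (∑ d ∈ ((p - 1) / m).divisors, ((d * m).totient : ℝ) / ((d * m : ℕ) : ℝ)) ^ 2) /
              ((p - 1 : ℕ) : ℝ) ∧
      (1 / (Nat.primeCounting x : ℝ)) *
          ∑ p ∈ Finset.filter Nat.Prime (Finset.Iic x),
            (∑ m ∈ (p - 1).divisors, (m.totient : ℝ) *
              (∑ d ∈ ((p - 1) / m).divisors, ((d * m).totient : ℝ) / ((d * m : ℕ) : ℝ)) ^ 2) /
              ((p - 1 : ℕ) : ℝ) ≤ (3.422 : ℝ) := by
  have n1 : (1.444 : ℝ) < Real.pi ^ 2 / 6 := by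
    nlinarith [Real.pi_gt_d2]
  have n2 : Real.pi ^ 2 / 6 < (3.422 : ℝ) := by
    nlinarith [Real.pi_lt_d2, Real.pi_gt_d2]
  have h1 := average_tendsto.eventually (Ici_mem_nhds n1)
  have h2 := average_tendsto.eventually (Iic_mem_nhds n2)
  obtain ⟨x₀, hx⟩ := Filter.eventually_atTop.mp (h1.and h2)
  exact ⟨x₀, hx⟩
end
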